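/- arXiv:1903.01393 — 11 statements merged into one kernel-verified Lean document; each statement's English description precedes it below -/
import Mathlib

section
/- Let n ≥ 4, set ℓ = n − 3, and let (d, r) be an arithmetical structure on the bident D_n. The following three conditions are equivalent: (a) d_i ≥ 2 for all i ∈ {1, 2, …, ℓ}; (b) r_0 − r_1 ≥ r_1 − r_2 ≥ ⋯ ≥ r_{ℓ−1} − r_ℓ > 0; (c) r_0 > r_1 > ⋯ > r_ℓ. -/
/-- `IsArith n dx dy d rx ry r` says that `(d, r)` is an arithmetical structure on the
bident `D_n` (with `ℓ = n - 3`): `dx, dy, rx, ry` are the values at the prong vertices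
`v_x, v_y`, and `d i, r i` (for `0 ≤ i ≤ n - 3`) are the values at the path vertices
`v_0, v_1, …, v_ℓ`. -/
def IsArith (n dx dy : ℕ) (d : ℕ → ℕ) (rx ry : ℕ) (r : ℕ → ℕ) : Prop :=
  3 ≤ n ∧
  0 < dx ∧ 0 < dy ∧ (∀ i, i ≤ n - 3 → 0 < d i) ∧
  0 < rx ∧ 0 < ry ∧ (∀ i, i ≤ n - 3 → 0 < r i) ∧
  dx * rx = r 0 ∧ dy * ry = r 0 ∧
  (1 ≤ n - 3 → d 0 * r 0 = rx + ry + r 1) ∧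
  (n - 3 = 0 → d 0 * r 0 = rx + ry) ∧
  (∀ i, 1 ≤ i → i + 1 ≤ n - 3 → d i * r i = r (i - 1) + r (i + 1)) ∧
  (1 ≤ n - 3 → d (n - 3) * r (n - 3) = r (n - 3 - 1)) ∧
  (∀ c : ℕ, c ∣ rx → c ∣ ry → (∀ i, i ≤ n - 3 → c ∣ r i) → c = 1)

/-- An arithmetical structure on `D_n` is *smooth* if `d_x, d_y ≥ 2` and `d_i ≥ 2` for all
`1 ≤ i ≤ ℓ = n - 3`. -/
def IsSmooth (n dx dy : ℕ) (d : ℕ → ℕ) : Prop :=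
  2 ≤ dx ∧ 2 ≤ dy ∧ ∀ i, 1 ≤ i → i ≤ n - 3 → 2 ≤ d i

/-- **Lemma 2.2.**  Let `n ≥ 4` and let `(d, r)` be an arithmetical structure on the bident
`D_n` (with `ℓ = n - 3`).  The following are equivalent:
(a) `d_i ≥ 2` for all `1 ≤ i ≤ ℓ`;
(b) `r_0 - r_1 ≥ r_1 - r_2 ≥ ⋯ ≥ r_{ℓ-1} - r_ℓ > 0`;
(c) `r_0 > r_1 > ⋯ > r_ℓ`. -/
theorem bident_smooth_tail_tfae (n : ℕ) (hn : 4 ≤ n) (dx dy rx ry : ℕ) (d r : ℕ → ℕ)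
    (h : IsArith n dx dy d rx ry r) :
    ((∀ i, 1 ≤ i → i ≤ n - 3 → 2 ≤ d i) ↔
      ((∀ i, 1 ≤ i → i + 1 ≤ n - 3 →
          ((r i : ℤ) - (r (i + 1) : ℤ)) ≤ ((r (i - 1) : ℤ) - (r i : ℤ))) ∧
        (0 : ℤ) < (r (n - 3 - 1) : ℤ) - (r (n - 3) : ℤ))) ∧
    (((∀ i, 1 ≤ i → i + 1 ≤ n - 3 →
          ((r i : ℤ) - (r (i + 1) : ℤ)) ≤ ((r (i - 1) : ℤ) - (r i : ℤ))) ∧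
        (0 : ℤ) < (r (n - 3 - 1) : ℤ) - (r (n - 3) : ℤ)) ↔
      (∀ i, i + 1 ≤ n - 3 → r (i + 1) < r i)) := by
  obtain ⟨-, -, -, -, -, -, hr, -, -, -, -, hmid, hlast, -⟩ := h
  obtain ⟨l, hl⟩ : ∃ l, n - 3 = l + 1 := ⟨n - 4, by omega⟩
  simp only [hl, Nat.add_sub_cancel] at *
  have hend := hlast (by omega)
  have hab : (∀ i, 1 ≤ i → i ≤ l + 1 → 2 ≤ d i) →
      ((∀ i, 1 ≤ i → i + 1 ≤ l + 1 →
          ((r i : ℤ) - (r (i + 1) : ℤ)) ≤ ((r (i - 1) : ℤ) - (r i : ℤ))) ∧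
        (0 : ℤ) < (r l : ℤ) - (r (l + 1) : ℤ)) := by
    intro ha
    refine ⟨fun i h1 h2 => ?_, ?_⟩
    · have := Nat.mul_le_mul_right (r i) (ha i h1 (by omega))
      have := hmid i h1 h2
      omega
    · have := Nat.mul_le_mul_right (r (l + 1)) (ha (l + 1) (by omega) le_rfl)
      have := hr (l + 1) le_rfl
      omega
  have hbc : ((∀ i, 1 ≤ i → i + 1 ≤ l + 1 →
          ((r i : ℤ) - (r (i + 1) : ℤ)) ≤ ((r (i - 1) : ℤ) - (r i : ℤ))) ∧
        (0 : ℤ) < (r l : ℤ) - (r (l + 1) : ℤ)) →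
      ∀ i, i + 1 ≤ l + 1 → r (i + 1) < r i := by
    rintro ⟨hdiff, hpos⟩ i hi
    induction Nat.le_of_succ_le_succ hi using Nat.decreasingInduction with
    | self => omega
    | of_succ k hk ih =>
      have := hdiff (k + 1) (by omega) (by omega)
      have := ih (by omega)
      simp only [Nat.add_sub_cancel] at *
      omega
  have hca : (∀ i, i + 1 ≤ l + 1 → r (i + 1) < r i) →
      ∀ i, 1 ≤ i → i ≤ l + 1 → 2 ≤ d i := by
    intro hc i h1 h2
    obtain ⟨k, rfl⟩ := Nat.exists_eq_add_of_le' h1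
    have hk := hc k h2
    by_contra! hd
    have hle := Nat.mul_le_mul_right (r (k + 1)) (Nat.le_of_lt_succ hd)
    rcases h2.lt_or_eq with h2 | h2
    · have := hmid (k + 1) h1 h2
      simp only [Nat.add_sub_cancel] at this
      omega
    · obtain rfl : k = l := by omega
      omega
  exact ⟨⟨hab, fun hb => hca (hbc hb)⟩, ⟨hbc, fun hc => hab (hca hc)⟩⟩
end

section
/- Every smooth arithmetical structure (d, r) on the bident D_n with n ≥ 3 satisfies d_0 = 1. -/
/-- The values of `r` strictly decrease along the path of a smooth arithmetical structure. -/
theorem IsArith.path_lt {n dx dy rx ry : ℕ} {d r : ℕ → ℕ} (h : IsArith n dx dy d rx ry r)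
    (hs : IsSmooth n dx dy d) (k : ℕ) (hk : k + 1 ≤ n - 3) :
    r (n - 3 - k) < r (n - 3 - k - 1) := by
  obtain ⟨-, -, -, -, -, -, hr, -, -, -, -, hpath, hlast, -⟩ := h
  obtain ⟨-, -, hd⟩ := hs
  induction k with
  | zero =>
    have h1 := hlast (by omega)
    have h2 := hd (n - 3) (by omega) le_rfl
    have h3 := hr (n - 3) le_rfl
    simp only [Nat.sub_zero]
    nlinarith
  | succ k ih =>
    have ih := ih (by omega)
    obtain ⟨m, hm⟩ : ∃ m, n - 3 - k = m + 2 := ⟨n - 3 - k - 2, by omega⟩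
    have e : n - 3 - (k + 1) = m + 1 := by omega
    rw [hm] at ih
    rw [e]
    have h1 := hpath (m + 1) (by omega) (by omega)
    have h2 := hd (m + 1) (by omega) (by omega)
    simp only [Nat.add_sub_cancel, show m + 2 - 1 = m + 1 by omega,
      show m + 1 + 1 = m + 2 by omega] at h1 ih ⊢
    nlinarith

/-- **Proposition 2.4.**  Every smooth arithmetical structure `(d, r)` on the bident `D_n`
with `n ≥ 3` satisfies `d_0 = 1`. -/
theorem smooth_central_d_eq_one (n : ℕ) (hn : 3 ≤ n) (dx dy rx ry : ℕ) (d r : ℕ → ℕ)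
    (h : IsArith n dx dy d rx ry r) (hs : IsSmooth n dx dy d) : d 0 = 1 := by
  have hlt := h.path_lt hs (n - 3 - 1)
  obtain ⟨-, -, -, hd, hrx, hry, hr, hx, hy, h0, h0', -, -, -⟩ := h
  obtain ⟨hdx, hdy, -⟩ := hs
  have hd0 := hd 0 (Nat.zero_le _)
  have hr0 := hr 0 (Nat.zero_le _)
  have hx2 : 2 * rx ≤ r 0 := hx ▸ Nat.mul_le_mul_right rx hdx
  have hy2 : 2 * ry ≤ r 0 := hy ▸ Nat.mul_le_mul_right ry hdy
  have key : d 0 * r 0 < 2 * r 0 := by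
    rcases Nat.eq_zero_or_pos (n - 3) with hl | hl
    · have := h0' hl
      omega
    · have h1 := h0 hl
      have h2 := hlt (by omega)
      rw [show n - 3 - (n - 3 - 1) = 1 by omega] at h2
      simp only [Nat.sub_self] at h2
      omega
  have : d 0 < 2 := lt_of_mul_lt_mul_right key (Nat.zero_le _)
  omega
end

section
/- For every triple of positive integers a, b, c with gcd(a, b, c) = 1, a ∣ c, b ∣ c, a < c, and b < c, there is a unique integer n ≥ 3 for which there exists a smooth arithmetical structure on D_n with r_x = a, r_y = b, and r_0 = c; moreover, for that n, the smooth arithmetical structure on D_n with r_x = a, r_y = b, and r_0 = c is unique. -/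
/-- The least natural number `x` such that `q ∣ p + x` (and `0` if `q = 0`). -/
def negMod (p q : ℕ) : ℕ := (q - p % q) % q

theorem negMod_lt (p : ℕ) {q : ℕ} (hq : 0 < q) : negMod p q < q := Nat.mod_lt _ hq

theorem dvd_add_negMod (p : ℕ) {q : ℕ} (hq : 0 < q) : q ∣ p + negMod p q := by
  have hlt : p % q < q := Nat.mod_lt p hq
  apply Nat.dvd_of_mod_eq_zero
  rw [negMod, Nat.add_mod_mod, Nat.add_mod, Nat.add_mod_mod,
    Nat.add_sub_cancel' hlt.le, Nat.mod_self]

theorem eq_negMod_of_dvd {p q x : ℕ} (hx : x < q) (h : q ∣ p + x) : x = negMod p q := by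
  have h' := dvd_add_negMod p (Nat.zero_lt_of_lt hx)
  have hmod : p + x ≡ p + negMod p q [MOD q] :=
    ((Nat.modEq_zero_iff_dvd).2 h).trans ((Nat.modEq_zero_iff_dvd).2 h').symm
  exact (Nat.ModEq.add_left_cancel' p hmod).eq_of_lt_of_lt hx
    (negMod_lt p (Nat.zero_lt_of_lt hx))

/-- The remainder sequence of the Euclidean algorithm with negative remainders, started at
`s, c`. -/
def negEuclid (s c : ℕ) : ℕ → ℕ
  | 0 => s
  | 1 => c
  | i + 2 => negMod (negEuclid s c i) (negEuclid s c (i + 1))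

theorem negEuclid_succ_lt (s c i : ℕ) (h : 0 < negEuclid s c (i + 1)) :
    negEuclid s c (i + 2) < negEuclid s c (i + 1) := by
  rw [negEuclid]
  exact negMod_lt _ h

theorem exists_negEuclid_eq_zero (s c : ℕ) : ∃ m, negEuclid s c (m + 2) = 0 := by
  by_contra! h
  have key : ∀ i, negEuclid s c (i + 2) + i ≤ negEuclid s c 2 := by
    intro i
    induction i with
    | zero => simp
    | succ i ih =>
      have := negEuclid_succ_lt s c (i + 1) (Nat.pos_of_ne_zero (h i))
      have e : i + 1 + 1 = i + 2 := rfl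
      rw [e] at this
      omega
  have h1 := key (negEuclid s c 2)
  have h2 := h (negEuclid s c 2)
  omega

/-- A positive sequence of length `ℓ + 1` following `s`, extended by `0`, whose terms divide the
sums of their neighbours with quotients at least `2` after the first one, is `negEuclid`. -/
theorem eq_negEuclid_of_mul_eq {ℓ : ℕ} {d R : ℕ → ℕ}
    (hpos : ∀ i, i ≤ ℓ → 0 < R (i + 1)) (hzero : R (ℓ + 2) = 0)
    (hmul : ∀ i, i ≤ ℓ → d i * R (i + 1) = R i + R (i + 2))
    (hd : ∀ i, 1 ≤ i → i ≤ ℓ → 2 ≤ d i) :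
    ∀ i, i ≤ ℓ + 2 → R i = negEuclid (R 0) (R 1) i := by
  have hlt : ∀ k i, i + k = ℓ → R (i + 2) < R (i + 1) := by
    intro k
    induction k with
    | zero =>
      rintro i rfl
      simpa [hzero] using hpos i le_rfl
    | succ k ih =>
      intro i hi
      have h1 := ih (i + 1) (by omega)
      have h2 := hmul (i + 1) (by omega)
      have h3 := Nat.mul_le_mul_right (R (i + 1 + 1)) (hd (i + 1) (by omega) (by omega))
      simp only [Nat.add_assoc, Nat.reduceAdd] at h1 h2 h3
      omega
  intro i
  induction i using Nat.strong_induction_on with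
  | _ i ih =>
    match i with
    | 0 => exact fun _ => rfl
    | 1 => exact fun _ => rfl
    | i + 2 =>
      intro hi
      rw [negEuclid, ← ih i (by omega) (by omega), ← ih (i + 1) (by omega) (by omega)]
      exact eq_negMod_of_dvd (hlt (ℓ - i) i (by omega))
        (Dvd.intro_left _ (hmul i (by omega)))

/-- In a smooth arithmetical structure on the bident, the values `r i` are the remainders of the
Euclidean algorithm with negative remainders, and these also determine the values `d i`. -/
theorem IsArith.eq_negEuclid {n dx dy rx ry : ℕ} {d r : ℕ → ℕ}
    (h : IsArith n dx dy d rx ry r) (hs : IsSmooth n dx dy d) :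
    (∀ i, i ≤ n - 3 → r i = negEuclid (rx + ry) (r 0) (i + 1)) ∧
    negEuclid (rx + ry) (r 0) (n - 3 + 2) = 0 ∧
    ∀ i, i ≤ n - 3 → d i * r i =
      negEuclid (rx + ry) (r 0) i + negEuclid (rx + ry) (r 0) (i + 2) := by
  obtain ⟨-, -, -, -, -, -, hr, -, -, h0, h0', hi, hl, -⟩ := h
  obtain ⟨-, -, hd⟩ := hs
  generalize n - 3 = ℓ at *
  let R : ℕ → ℕ := fun i => if i = 0 then rx + ry else if i ≤ ℓ + 1 then r (i - 1) else 0
  have hR0 : R 0 = rx + ry := rfl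
  have hR : ∀ i, i ≤ ℓ → R (i + 1) = r i := fun i hi => by simp [R, hi]
  have hRl : R (ℓ + 2) = 0 := by simp [R]
  have hmul : ∀ i, i ≤ ℓ → d i * R (i + 1) = R i + R (i + 2) := by
    intro i hil
    rw [hR i hil]
    rcases hil.lt_or_eq with hlt | rfl
    · rw [hR (i + 1) hlt]
      cases i with
      | zero => exact h0 (by omega)
      | succ i =>
        rw [hR i (by omega)]
        exact hi (i + 1) (by omega) (by omega)
    · rw [hRl]
      cases i with
      | zero => exact h0' rfl
      | succ i =>
        rw [hR i (by omega)]
        exact hl (by omega)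
  have key := eq_negEuclid_of_mul_eq (fun i hi => (hR i hi).symm ▸ hr i hi) hRl hmul hd
  rw [hR0, hR 0 (Nat.zero_le _)] at key
  refine ⟨fun i hi => ?_, ?_, fun i hi => ?_⟩
  · rw [← key (i + 1) (by omega), hR i hi]
  · rw [← key (ℓ + 2) le_rfl, hRl]
  · rw [← key i (by omega), ← key (i + 2) (by omega), ← hmul i hi, hR i hi]

/-- The number of vertices of a smooth arithmetical structure on a bident is determined by
`r_x + r_y` and `r_0`. -/
theorem IsArith.le_of_smooth {n dx dy rx ry n' dx' dy' rx' ry' : ℕ} {d r d' r' : ℕ → ℕ}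
    (h : IsArith n dx dy d rx ry r) (hs : IsSmooth n dx dy d)
    (h' : IsArith n' dx' dy' d' rx' ry' r') (hs' : IsSmooth n' dx' dy' d')
    (hsum : rx + ry = rx' + ry') (h0 : r 0 = r' 0) : n ≤ n' := by
  by_contra! hlt
  have hn' : 3 ≤ n' := h'.1
  have hpos : 0 < r (n' - 3 + 1) := h.2.2.2.2.2.2.1 _ (by omega)
  rw [(h.eq_negEuclid hs).1 (n' - 3 + 1) (by omega), hsum, h0] at hpos
  exact hpos.ne' (h'.eq_negEuclid hs').2.1

/-- The remainders of the Euclidean algorithm with negative remainders yield a smooth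
arithmetical structure on a bident. -/
theorem exists_smooth_isArith {a b c : ℕ} (ha : 0 < a) (hb : 0 < b) (hc : 0 < c)
    (hgcd : Nat.gcd a (Nat.gcd b c) = 1) (hac : a ∣ c) (hbc : b ∣ c)
    (haltc : a < c) (hbltc : b < c) :
    ∃ n dx dy d r, IsArith n dx dy d a b r ∧ IsSmooth n dx dy d ∧ r 0 = c := by
  obtain ⟨m, hm, hmin⟩ : ∃ m, negEuclid (a + b) c (m + 2) = 0 ∧
      ∀ k < m, negEuclid (a + b) c (k + 2) ≠ 0 :=
    ⟨Nat.find (exists_negEuclid_eq_zero (a + b) c),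
      Nat.find_spec (exists_negEuclid_eq_zero (a + b) c),
      fun k hk => Nat.find_min (exists_negEuclid_eq_zero (a + b) c) hk⟩
  set T := negEuclid (a + b) c with hT
  have hT0 : T 0 = a + b := by rw [hT, negEuclid]
  have hT1 : T 1 = c := by rw [hT, negEuclid]
  have hpos : ∀ i, i ≤ m → 0 < T (i + 1) := by
    intro i hi
    cases i with
    | zero => exact hT1.symm ▸ hc
    | succ i => exact Nat.pos_of_ne_zero (hmin i hi)
  have hdvd : ∀ i, i ≤ m → T (i + 1) ∣ T i + T (i + 2) := by
    intro i hi
    have h2 : T (i + 2) = negMod (T i) (T (i + 1)) := by rw [hT, negEuclid]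
    rw [h2]
    exact dvd_add_negMod _ (hpos i hi)
  obtain ⟨dx, hdx⟩ := hac
  obtain ⟨dy, hdy⟩ := hbc
  have hmul : ∀ i, i ≤ m → (T i + T (i + 2)) / T (i + 1) * T (i + 1) = T i + T (i + 2) :=
    fun i hi => Nat.div_mul_cancel (hdvd i hi)
  have hdx2 : 2 ≤ dx := by
    by_contra! h
    interval_cases dx <;> omega
  have hdy2 : 2 ≤ dy := by
    by_contra! h
    interval_cases dy <;> omega
  have hd2 : ∀ i, 1 ≤ i → i ≤ m → 2 ≤ (T i + T (i + 2)) / T (i + 1) := by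
    intro i h1 hi
    obtain ⟨i, rfl⟩ := Nat.exists_eq_add_of_le' h1
    have hlt : T (i + 2) < T (i + 1) := negEuclid_succ_lt _ _ i (hpos i (by omega))
    have e := hmul (i + 1) hi
    simp only [Nat.add_assoc, Nat.reduceAdd] at e ⊢
    by_contra! h
    have hle := Nat.mul_le_mul_right (T (i + 2)) (Nat.le_of_lt_succ h)
    omega
  refine ⟨m + 3, dx, dy, fun i => (T i + T (i + 2)) / T (i + 1), fun i => T (i + 1),
    ⟨by omega, by omega, by omega, fun i hi => ?_, ha, hb, hpos, ?_, ?_, fun _ => ?_, fun h => ?_,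
      fun i h1 hi => ?_, fun h => ?_, fun k ka kb kr => ?_⟩, ⟨hdx2, hdy2, hd2⟩, hT1⟩
  · rcases Nat.eq_zero_or_pos i with rfl | h
    · have e := hmul 0 (Nat.zero_le _)
      refine Nat.pos_of_ne_zero fun h => ?_
      simp only at h
      rw [h, hT0] at e
      omega
    · exact lt_of_lt_of_le two_pos (hd2 i h hi)
  · simp only [Nat.zero_add, hT1, hdx, Nat.mul_comm]
  · simp only [Nat.zero_add, hT1, Nat.mul_comm dy b, ← hdy]
  · simpa only [hT0] using hmul 0 (Nat.zero_le _)
  · obtain rfl : m = 0 := by omega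
    simpa only [hT0, hm, Nat.add_zero] using hmul 0 le_rfl
  · obtain ⟨i, rfl⟩ := Nat.exists_eq_add_of_le' h1
    exact hmul (i + 1) (by omega)
  · have e := hmul m le_rfl
    rw [hm, Nat.add_zero] at e
    simpa only [Nat.add_sub_cancel, Nat.sub_add_cancel (show 1 ≤ m from h), hm, Nat.add_zero]
      using e
  · have kc := kr 0 (Nat.zero_le _)
    simp only [Nat.zero_add, hT1] at kc
    exact Nat.dvd_one.1 (hgcd ▸ Nat.dvd_gcd ka (Nat.dvd_gcd kb kc))

/-- **Proposition 2.5.**  For every triple of positive integers `a, b, c` with no common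
factor such that `a, b ∣ c` and `a, b < c`, there is a unique `n ≥ 3` for which there is a
smooth arithmetical structure on `D_n` with `r_x = a`, `r_y = b`, and `r_0 = c`; moreover,
this smooth arithmetical structure on `D_n` is unique. -/
theorem smooth_unique_of_rx_ry_r0 (a b c : ℕ) (ha : 0 < a) (hb : 0 < b) (hc : 0 < c)
    (hgcd : Nat.gcd a (Nat.gcd b c) = 1) (hac : a ∣ c) (hbc : b ∣ c)
    (haltc : a < c) (hbltc : b < c) :
    (∃! n : ℕ, 3 ≤ n ∧ ∃ dx dy rx ry d r, IsArith n dx dy d rx ry r ∧ IsSmooth n dx dy d ∧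
        rx = a ∧ ry = b ∧ r 0 = c) ∧
    (∀ n dx dy d r dx' dy' d' r',
      IsArith n dx dy d a b r → IsSmooth n dx dy d → r 0 = c →
      IsArith n dx' dy' d' a b r' → IsSmooth n dx' dy' d' → r' 0 = c →
      dx = dx' ∧ dy = dy' ∧ ∀ i, i ≤ n - 3 → d i = d' i ∧ r i = r' i) := by
  constructor
  · obtain ⟨n, dx, dy, d, r, h, hs, h0⟩ :=
      exists_smooth_isArith ha hb hc hgcd hac hbc haltc hbltc
    refine ⟨n, ⟨h.1, dx, dy, a, b, d, r, h, hs, rfl, rfl, h0⟩, ?_⟩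
    rintro n' ⟨-, dx', dy', rx', ry', d', r', h', hs', rfl, rfl, h0'⟩
    exact le_antisymm (h'.le_of_smooth hs' h hs rfl (h0'.trans h0.symm))
      (h.le_of_smooth hs h' hs' rfl (h0.trans h0'.symm))
  · intro n dx dy d r dx' dy' d' r' h hs h0 h' hs' h0'
    obtain ⟨hr, -, hd⟩ := h.eq_negEuclid hs
    obtain ⟨hr', -, hd'⟩ := h'.eq_negEuclid hs'
    obtain ⟨-, -, -, -, -, -, hpos, hx, hy, -⟩ := h
    obtain ⟨-, -, -, -, -, -, -, hx', hy', -⟩ := h'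
    rw [h0] at hr hd hx hy
    rw [h0'] at hr' hd' hx' hy'
    refine ⟨Nat.eq_of_mul_eq_mul_right ha (hx.trans hx'.symm),
      Nat.eq_of_mul_eq_mul_right hb (hy.trans hy'.symm), fun i hi => ?_⟩
    have hri : r i = r' i := (hr i hi).trans (hr' i hi).symm
    refine ⟨Nat.eq_of_mul_eq_mul_right (hpos i hi) ?_, hri⟩
    rw [hd i hi, hri, hd' i hi]
end

section
/- Let n ≥ 4, set ℓ = n − 3, and let (d, r) be an arithmetical structure on the bident D_n. Then (a) gcd(r_x, r_y) = 1, and (b) gcd(r_0, r_1) = r_ℓ. -/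
/-- Along a path with `d i * r i = r (i - 1) + r (i + 1)` at inner vertices, a common divisor of
the first two values divides all values. -/
theorem dvd_path_of_dvd_start {d r : ℕ → ℕ} {l c : ℕ}
    (h : ∀ i, 1 ≤ i → i + 1 ≤ l → d i * r i = r (i - 1) + r (i + 1))
    (h0 : c ∣ r 0) (h1 : c ∣ r 1) (i : ℕ) (hi : i ≤ l) : c ∣ r i := by
  induction i using Nat.strong_induction_on with
  | _ i ih =>
    match i with
    | 0 => exact h0
    | 1 => exact h1
    | k + 2 =>
      have hk : d (k + 1) * r (k + 1) = r k + r (k + 2) := h (k + 1) (by omega) hi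
      exact (Nat.dvd_add_right (ih k (by omega) (by omega))).1
        (hk ▸ (ih (k + 1) (by omega) (by omega)).mul_left _)

/-- Along a path with `d i * r i = r (i - 1) + r (i + 1)` at inner vertices and
`d l * r l = r (l - 1)` at the end, the last value divides all values. -/
theorem path_end_dvd {d r : ℕ → ℕ} {l : ℕ}
    (h : ∀ i, 1 ≤ i → i + 1 ≤ l → d i * r i = r (i - 1) + r (i + 1))
    (hl : d l * r l = r (l - 1)) (i : ℕ) (hi : i ≤ l) : r l ∣ r i := by
  have key := dvd_path_of_dvd_start (d := fun j => d (l - j)) (r := fun j => r (l - j))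
    (l := l) (c := r l) (fun j hj hjl => by
      have := h (l - j) (by omega) (by omega)
      rw [show l - j - 1 = l - (j + 1) by omega, show l - j + 1 = l - (j - 1) by omega] at this
      exact this.trans (Nat.add_comm _ _)) dvd_rfl (Dvd.intro_left _ hl) (l - i) (Nat.sub_le _ _)
  simpa [Nat.sub_sub_self hi] using key

/-- **Lemma 2.6.**  Let `n ≥ 4`, `ℓ = n - 3`, and let `(d, r)` be an arithmetical structure
on the bident `D_n`.  Then (a) `gcd(r_x, r_y) = 1` and (b) `gcd(r_0, r_1) = r_ℓ`. -/
theorem bident_gcd (n : ℕ) (hn : 4 ≤ n) (dx dy rx ry : ℕ) (d r : ℕ → ℕ)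
    (h : IsArith n dx dy d rx ry r) :
    Nat.gcd rx ry = 1 ∧ Nat.gcd (r 0) (r 1) = r (n - 3) := by
  obtain ⟨-, -, -, -, -, -, -, hx, -, h0, -, hi, hl, hc⟩ := h
  have h0 := h0 (by omega)
  have hl := hl (by omega)
  constructor
  · have hgx := Nat.gcd_dvd_left rx ry
    have hgy := Nat.gcd_dvd_right rx ry
    have hg0 : Nat.gcd rx ry ∣ r 0 := hx ▸ hgx.mul_left dx
    have hg1 : Nat.gcd rx ry ∣ r 1 :=
      (Nat.dvd_add_right (hgx.add hgy)).1 (h0 ▸ hg0.mul_left (d 0))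
    exact hc _ hgx hgy (dvd_path_of_dvd_start hi hg0 hg1)
  · exact Nat.dvd_antisymm
      (dvd_path_of_dvd_start hi (Nat.gcd_dvd_left _ _) (Nat.gcd_dvd_right _ _) _ le_rfl)
      (Nat.dvd_gcd (path_end_dvd hi hl 0 (by omega)) (path_end_dvd hi hl 1 (by omega)))
end

section
/- For integers n ≥ 1 and 0 ≤ k ≤ n, the number of nondecreasing sequences (b_1, b_2, …, b_n) of positive integers satisfying b_i ≤ i for all i, and additionally b_j = 1 for all j ≤ k, is equal to the ballot number B(n, n − k). -/
/-- The ballot number `B(n, k) = ((n - k + 1)/(n + 1)) * choose (n + k) n`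
(the division is exact for `k ≤ n`). -/
def ballot (n k : ℕ) : ℕ := (n - k + 1) * Nat.choose (n + k) n / (n + 1)

/-- Nondecreasing sequences of positive integers with `b_i ≤ i` that start with `k` ones,
where index `i : Fin n` encodes `b_{i+1}`. -/
def ballotSequences (n k : ℕ) : Set (Fin n → ℕ) :=
  {b | Monotone b ∧ (∀ i : Fin n, 1 ≤ b i ∧ b i ≤ (i : ℕ) + 1) ∧
    ∀ j : Fin n, (j : ℕ) < k → b j = 1}

/-- Prepend a one and increase by one all entries after the first `k`. -/
def raiseAfter (n k : ℕ) (c : Fin n → ℕ) : Fin (n + 1) → ℕ :=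
  Fin.cons 1 fun i => if (i : ℕ) < k then 1 else c i + 1

theorem ballotSequences_finite (n k : ℕ) : (ballotSequences n k).Finite :=
  (Set.Finite.pi' fun i : Fin n => Set.finite_Icc 1 ((i : ℕ) + 1)).subset
    fun _ hb i => hb.2.1 i

theorem ballotSequences_self (n : ℕ) : ballotSequences n n = {fun _ => 1} := by
  ext b
  constructor
  · rintro ⟨-, -, h⟩
    exact funext fun i => h i i.2
  · rintro rfl
    exact ⟨monotone_const, fun i => by simp, fun _ _ => rfl⟩

theorem ballotSequences_succ_zero (n : ℕ) :
    ballotSequences (n + 1) 0 = ballotSequences (n + 1) 1 := by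
  ext b
  refine and_congr_right fun _ => and_congr_right fun hb => ?_
  refine ⟨fun _ j hj => ?_, fun _ j hj => absurd hj (Nat.not_lt_zero _)⟩
  have := hb j
  omega

theorem raiseAfter_injOn (n k : ℕ) : Set.InjOn (raiseAfter n k) (ballotSequences n k) := by
  intro b hb c hc h
  funext i
  by_cases hi : (i : ℕ) < k
  · rw [hb.2.2 i hi, hc.2.2 i hi]
  · simpa [raiseAfter, hi] using congrFun h i.succ

theorem raiseAfter_mem {n k : ℕ} {c : Fin n → ℕ} (hc : c ∈ ballotSequences n k) :
    raiseAfter n k c ∈ ballotSequences (n + 1) (k + 1) := by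
  obtain ⟨hmono, hbd, -⟩ := hc
  have hbd' : ∀ i, 1 ≤ raiseAfter n k c i ∧ raiseAfter n k c i ≤ (i : ℕ) + 1 := by
    intro i
    refine Fin.cases (by simp [raiseAfter]) (fun i => ?_) i
    have := hbd i
    simp only [raiseAfter, Fin.cons_succ, Fin.val_succ]
    split_ifs <;> omega
  refine ⟨fun i j hij => ?_, hbd', fun j hj => ?_⟩
  · induction i using Fin.cases with
    | zero => exact (hbd' j).1
    | succ i =>
      induction j using Fin.cases with
      | zero => exact absurd hij (by simp)
      | succ j =>
        have hij' : i ≤ j := Fin.succ_le_succ_iff.mp hij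
        have := hmono hij'
        have : (i : ℕ) ≤ j := hij'
        simp only [raiseAfter, Fin.cons_succ]
        split_ifs <;> omega
  · induction j using Fin.cases with
    | zero => rfl
    | succ j =>
      have : (j : ℕ) < k := by simpa using hj
      simp [raiseAfter, this]

theorem exists_raiseAfter_eq {n k : ℕ} {b : Fin (n + 1) → ℕ}
    (hb : b ∈ ballotSequences (n + 1) (k + 1)) (hb' : b ∉ ballotSequences (n + 1) (k + 2)) :
    ∃ c ∈ ballotSequences n k, raiseAfter n k c = b := by
  obtain ⟨hmono, hbd, hone⟩ := hb
  have hlarge : ∀ i : Fin n, k ≤ (i : ℕ) → 2 ≤ b i.succ := by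
    intro i hi
    by_contra! hlt
    refine hb' ⟨hmono, hbd, fun j hj => le_antisymm ?_ (hbd j).1⟩
    have hle : j ≤ i.succ := by
      rw [Fin.le_def, Fin.val_succ]
      omega
    have := hmono hle
    omega
  refine ⟨fun i => max 1 (b i.succ - 1), ⟨fun i j hij => ?_, fun i => ?_, fun j hj => ?_⟩, ?_⟩
  · have := hmono (Fin.succ_le_succ_iff.mpr hij)
    dsimp only
    omega
  · have := hbd i.succ
    rw [Fin.val_succ] at this
    exact ⟨le_max_left _ _, max_le (by omega) (by omega)⟩
  · have := hone j.succ (by simpa using hj)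
    simp [this]
  · funext i
    induction i using Fin.cases with
    | zero => exact (hone 0 (by simp)).symm
    | succ i =>
      simp only [raiseAfter, Fin.cons_succ]
      split_ifs with hi
      · exact (hone i.succ (by simpa using hi)).symm
      · have := hlarge i (by omega)
        omega

theorem ballotSequences_succ_succ (n k : ℕ) :
    ballotSequences (n + 1) (k + 1) =
      ballotSequences (n + 1) (k + 2) ∪ raiseAfter n k '' ballotSequences n k := by
  ext b
  constructor
  · intro hb
    by_cases hb' : b ∈ ballotSequences (n + 1) (k + 2)
    · exact Or.inl hb'
    · exact Or.inr (exists_raiseAfter_eq hb hb')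
  · rintro (⟨hmono, hbd, hone⟩ | ⟨c, hc, rfl⟩)
    · exact ⟨hmono, hbd, fun j hj => hone j (by omega)⟩
    · exact raiseAfter_mem hc

theorem disjoint_raiseAfter {n k : ℕ} (hk : k < n) :
    Disjoint (ballotSequences (n + 1) (k + 2)) (raiseAfter n k '' ballotSequences n k) := by
  rw [Set.disjoint_left]
  rintro _ hb ⟨c, hc, rfl⟩
  have h := hb.2.2 (Fin.succ ⟨k, hk⟩) (by simp)
  have := (hc.2.1 ⟨k, hk⟩).1
  simp only [raiseAfter, Fin.cons_succ, lt_irrefl, if_false] at h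
  omega

theorem ncard_ballotSequences_succ_succ {n k : ℕ} (hk : k < n) :
    (ballotSequences (n + 1) (k + 1)).ncard =
      (ballotSequences (n + 1) (k + 2)).ncard + (ballotSequences n k).ncard := by
  rw [ballotSequences_succ_succ, Set.ncard_union_eq (disjoint_raiseAfter hk)
    (ballotSequences_finite _ _) ((ballotSequences_finite _ _).image _),
    (raiseAfter_injOn n k).ncard_image]

theorem ncard_ballotSequences_add_choose (m k : ℕ) :
    (ballotSequences (m + k) k).ncard + (2 * m + k).choose (m + k + 1) =
      (2 * m + k).choose (m + k) := by
  induction m generalizing k with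
  | zero =>
    have hself : ∀ n, n = k → (ballotSequences n k).ncard = 1 := by
      rintro _ rfl
      rw [ballotSequences_self, Set.ncard_singleton]
    simp [hself (0 + k) (zero_add k)]
  | succ m ihm =>
    induction k with
    | zero =>
      have h := ihm 1
      have hsymm : (2 * m + 1).choose (m + 1) = (2 * m + 1).choose m :=
        Nat.choose_symm_half m
      have h₁ := Nat.choose_succ_succ (2 * m + 1) m
      have h₂ := Nat.choose_succ_succ (2 * m + 1) (m + 1)
      simp only [Nat.succ_eq_add_one, add_assoc, Nat.reduceAdd] at h h₁ h₂
      simp only [add_zero, ballotSequences_succ_zero, mul_add, mul_one, add_assoc,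
        Nat.reduceAdd]
      omega
    | succ k ihk =>
      have h : (ballotSequences (m + k + 2) (k + 2)).ncard +
          (2 * m + k + 2).choose (m + k + 3) = (2 * m + k + 2).choose (m + k + 2) := ihm (k + 2)
      have h₁ : (2 * m + k + 3).choose (m + k + 2) =
          (2 * m + k + 2).choose (m + k + 1) + (2 * m + k + 2).choose (m + k + 2) :=
        Nat.choose_succ_succ _ _
      have h₂ : (2 * m + k + 3).choose (m + k + 3) =
          (2 * m + k + 2).choose (m + k + 2) + (2 * m + k + 2).choose (m + k + 3) :=
        Nat.choose_succ_succ _ _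
      have hrec : (ballotSequences (m + k + 2) (k + 1)).ncard =
          (ballotSequences (m + k + 2) (k + 2)).ncard +
            (ballotSequences (m + k + 1) k).ncard :=
        ncard_ballotSequences_succ_succ (by omega)
      rw [show m + 1 + k = m + k + 1 by ring, show 2 * (m + 1) + k = 2 * m + k + 2 by ring]
        at ihk
      change _ + (2 * m + k + 2).choose (m + k + 2) = _ at ihk
      rw [show m + 1 + (k + 1) = m + k + 2 by ring,
        show 2 * (m + 1) + (k + 1) = 2 * m + k + 3 by ring]
      change _ + (2 * m + k + 3).choose (m + k + 3) = _
      omega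

theorem ncard_ballotSequences_mul (m k : ℕ) :
    (m + k + 1) * (ballotSequences (m + k) k).ncard =
      (k + 1) * (2 * m + k).choose (m + k) := by
  have h := ncard_ballotSequences_add_choose m k
  have habs := Nat.choose_succ_right_eq (2 * m + k) (m + k)
  rw [show 2 * m + k - (m + k) = m by omega] at habs
  zify at h habs ⊢
  linear_combination ((m : ℤ) + k + 1) * h - habs

/-- **Lemma 2.9.**  For `n ≥ 1` and `0 ≤ k ≤ n`, the number of nondecreasing sequences
`(b_1, …, b_n)` of positive integers with `b_i ≤ i` for all `i` and `b_j = 1` for all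
`j ≤ k` is the ballot number `B(n, n - k)`.  (Index `i : Fin n` encodes `b_{i+1}`.) -/
theorem count_nondecreasing_sequences (n k : ℕ) (hn : 1 ≤ n) (hk : k ≤ n) :
    Nat.card {b : Fin n → ℕ // Monotone b ∧ (∀ i : Fin n, 1 ≤ b i ∧ b i ≤ (i : ℕ) + 1) ∧
      ∀ j : Fin n, (j : ℕ) < k → b j = 1} = ballot n (n - k) := by
  change (ballotSequences n k).ncard = _
  obtain ⟨m, rfl⟩ := Nat.exists_eq_add_of_le' hk
  rw [ballot, Nat.add_sub_cancel, Nat.add_sub_cancel_left,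
    show m + k + m = 2 * m + k by ring, ← ncard_ballotSequences_mul,
    Nat.mul_div_cancel_left _ (Nat.succ_pos _)]
end

section
/- Let x and a be positive integers and let y and k be nonnegative integers. Then: (a) F(x, y) = F(x + ky, y); (b) F(x, kx + y) = F(x, y) + k; (c) F(ax, ay) = F(x, y); (d) F(x, x − 1) = x; (e) F(x, y) ≤ y + 1; (f) if 1 ≤ y ≤ x − 2, then F(x, y) ≤ (x + 1)/2. -/
/-- `F x₁ x₂` is the number of positive terms of the sequence `x₁, x₂, x₃, …` in which
`x_{i+1}` is the least nonnegative residue of `-x_{i-1}` modulo `x_i` (the sequence is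
continued as long as `x_i > 0`).  In particular `F x 0 = 1`. -/
def F (x y : ℕ) : ℕ :=
  if h : y = 0 then 1
  else 1 + F y ((y - x % y) % y)
termination_by y
decreasing_by exact Nat.mod_lt _ (Nat.pos_of_ne_zero h)

theorem F_zero_right (x : ℕ) : F x 0 = 1 := by
  rw [F, dif_pos rfl]

theorem F_of_pos (x : ℕ) {y : ℕ} (hy : 0 < y) : F x y = 1 + F y ((y - x % y) % y) := by
  rw [F, dif_neg hy.ne']

theorem F_add_mul_left (x y k : ℕ) : F (x + k * y) y = F x y := by
  rcases y.eq_zero_or_pos with rfl | hy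
  · simp
  · rw [F_of_pos _ hy, F_of_pos x hy, Nat.add_mul_mod_self_right]

theorem F_self_add {x : ℕ} (hx : 0 < x) (y : ℕ) : F x (x + y) = F x y + 1 := by
  have residue : (x + y - x % (x + y)) % (x + y) = y := by
    rcases y.eq_zero_or_pos with rfl | hy
    · simp
    · rw [Nat.mod_eq_of_lt (by omega : x < x + y), Nat.add_sub_cancel_left,
        Nat.mod_eq_of_lt (by omega)]
  rw [F_of_pos x (by omega), residue, add_comm]
  simpa using F_add_mul_left x y 1

theorem F_mul_add {x : ℕ} (hx : 0 < x) (y k : ℕ) : F x (k * x + y) = F x y + k := by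
  induction k with
  | zero => simp
  | succ k ih =>
    rw [show (k + 1) * x + y = x + (k * x + y) by ring, F_self_add hx, ih, add_assoc]

theorem F_mul_mul {a : ℕ} (ha : 0 < a) (x y : ℕ) : F (a * x) (a * y) = F x y := by
  induction y using Nat.strong_induction_on generalizing x with
  | _ y ih =>
    rcases y.eq_zero_or_pos with rfl | hy
    · simp [F_zero_right]
    · rw [F_of_pos _ (Nat.mul_pos ha hy), F_of_pos x hy, Nat.mul_mod_mul_left, ← Nat.mul_sub,
        Nat.mul_mod_mul_left, ih _ (Nat.mod_lt _ hy)]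

theorem F_succ_self (n : ℕ) : F (n + 1) n = n + 1 := by
  induction n with
  | zero => exact F_zero_right 1
  | succ n ih =>
    have residue : (n + 1 - (n + 1 + 1) % (n + 1)) % (n + 1) = n := by
      rw [Nat.add_mod_left]
      rcases n.eq_zero_or_pos with rfl | hn
      · simp
      · rw [Nat.mod_eq_of_lt (by omega : 1 < n + 1), Nat.add_sub_cancel,
          Nat.mod_eq_of_lt (by omega)]
    rw [F_of_pos _ n.succ_pos, residue, ih, add_comm]

theorem F_le_succ (x y : ℕ) : F x y ≤ y + 1 := by
  induction y using Nat.strong_induction_on generalizing x with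
  | _ y ih =>
    rcases y.eq_zero_or_pos with rfl | hy
    · simp [F_zero_right]
    · have hlt := Nat.mod_lt (y - x % y) hy
      have := ih _ hlt y
      rw [F_of_pos x hy]
      omega

theorem two_mul_F_le {x y : ℕ} (hy : 0 < y) (hyx : y + 2 ≤ x) : 2 * F x y ≤ x + 1 := by
  induction y using Nat.strong_induction_on generalizing x with
  | _ y ih =>
    rw [F_of_pos x hy]
    have hlt := Nat.mod_lt (y - x % y) hy
    obtain ⟨z, hz⟩ : ∃ z, (y - x % y) % y = z := ⟨_, rfl⟩
    rw [hz] at hlt ⊢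
    rcases z.eq_zero_or_pos with rfl | hz_pos
    · rw [F_zero_right]
      omega
    by_cases hzy : z + 2 ≤ y
    · have := ih z hlt hz_pos hzy
      omega
    · obtain rfl : y = z + 1 := by omega
      have hmod : x % (z + 1) = 1 := by
        have hr := Nat.mod_lt x hy
        rcases (x % (z + 1)).eq_zero_or_pos with h0 | hpos
        · rw [h0, Nat.sub_zero, Nat.mod_self] at hz
          omega
        · rw [Nat.mod_eq_of_lt (by omega)] at hz
          omega
      have hq := Nat.div_add_mod x (z + 1)
      have : 2 ≤ x / (z + 1) := by
        by_contra! h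
        have : (z + 1) * (x / (z + 1)) ≤ (z + 1) * 1 := Nat.mul_le_mul_left _ (by omega)
        omega
      have := Nat.mul_le_mul_left (z + 1) this
      rw [F_succ_self]
      omega

/-- **Lemma 3.2.**  Basic properties of the function `F`:  for `x, a` positive and
`y, k` nonnegative integers,
(a) `F(x, y) = F(x + ky, y)`;
(b) `F(x, kx + y) = F(x, y) + k`;
(c) `F(ax, ay) = F(x, y)`;
(d) `F(x, x - 1) = x`;
(e) `F(x, y) ≤ y + 1`;
(f) if `1 ≤ y ≤ x - 2` then `F(x, y) ≤ (x + 1)/2`. -/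
theorem F_basics (x a y k : ℕ) (hx : 0 < x) (ha : 0 < a) :
    F x y = F (x + k * y) y ∧
    F x (k * x + y) = F x y + k ∧
    F (a * x) (a * y) = F x y ∧
    F x (x - 1) = x ∧
    F x y ≤ y + 1 ∧
    (1 ≤ y → y ≤ x - 2 → (F x y : ℚ) ≤ ((x : ℚ) + 1) / 2) := by
  refine ⟨(F_add_mul_left x y k).symm, F_mul_add hx y k, F_mul_mul ha x y, ?_, F_le_succ x y,
    fun hy hyx => ?_⟩
  · obtain ⟨n, rfl⟩ := Nat.exists_eq_succ_of_ne_zero hx.ne'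
    exact F_succ_self n
  · rw [le_div_iff₀ two_pos, mul_comm]
    exact_mod_cast two_mul_F_le hy (by omega : y + 2 ≤ x)
end

section
/- Let n ≥ 3. Every smooth arithmetical structure (d, r) on the bident D_n satisfies 2 ≤ min{d_x, d_y} ≤ 2n − 4. -/
/-- A nonnegative sequence on `0, …, L`, extended by `0` at `L + 1`, that is convex at
`1, …, L` decays from `i` to `i + 1` at least as fast as the linear sequence vanishing
at `L + 1`. -/
lemma convex_decay (L : ℕ) (r : ℕ → ℕ)
    (hmid : ∀ i, 1 ≤ i → i + 1 ≤ L → 2 * r i ≤ r (i - 1) + r (i + 1))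
    (hend : 1 ≤ L → 2 * r L ≤ r (L - 1)) (k : ℕ) :
    ∀ i, i + (k + 1) = L → (k + 2) * r (i + 1) ≤ (k + 1) * r i := by
  induction k with
  | zero =>
    intro i hi
    subst hi
    simpa using hend (by omega)
  | succ k ih =>
    intro i hi
    have h1 := ih (i + 1) (by omega)
    have h2 := hmid (i + 1) (by omega) (by omega)
    rw [Nat.add_sub_cancel] at h2
    have h3 := Nat.mul_le_mul_left (k + 2) h2
    nlinarith

/-- **Proposition 3.6.**  Let `n ≥ 3`.  Every smooth arithmetical structure on the bident
`D_n` satisfies `2 ≤ min{d_x, d_y} ≤ 2n - 4`. -/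
theorem smooth_min_bound (n : ℕ) (hn : 3 ≤ n) (dx dy rx ry : ℕ) (d r : ℕ → ℕ)
    (h : IsArith n dx dy d rx ry r) (hs : IsSmooth n dx dy d) :
    2 ≤ min dx dy ∧ min dx dy ≤ 2 * n - 4 := by
  obtain ⟨-, -, -, hd, hrx, hry, hr, hx, hy, h0, h0', hmid, hend, -⟩ := h
  obtain ⟨hdx, hdy, hdi⟩ := hs
  refine ⟨le_min hdx hdy, ?_⟩
  have hax : min dx dy * rx ≤ r 0 := hx ▸ Nat.mul_le_mul_right _ (min_le_left _ _)
  have hay : min dx dy * ry ≤ r 0 := hy ▸ Nat.mul_le_mul_right _ (min_le_right _ _)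
  have hr0 : 0 < r 0 := hr 0 (by omega)
  have hd0 : 0 < d 0 := hd 0 (by omega)
  obtain ⟨L, rfl⟩ : ∃ L, n = L + 3 := ⟨n - 3, by omega⟩
  rw [Nat.add_sub_cancel] at *
  have hbound : 2 * (L + 3) - 4 = 2 * (L + 1) := by omega
  rw [hbound]
  generalize min dx dy = a at *
  have h2x : 2 * rx ≤ r 0 := hx ▸ Nat.mul_le_mul_right _ hdx
  have h2y : 2 * ry ≤ r 0 := hy ▸ Nat.mul_le_mul_right _ hdy
  rcases L with _ | k
  · have h1 := h0' rfl
    by_contra! hlt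
    nlinarith
  · have hdecay := convex_decay (k + 1) r
      (fun i hi hi' => hmid i hi hi' ▸ Nat.mul_le_mul_right _ (hdi i hi (by omega)))
      (fun hk => hend hk ▸ Nat.mul_le_mul_right _ (hdi _ hk le_rfl)) k 0 (by omega)
    rw [zero_add] at hdecay
    have h1 := h0 (by omega)
    have hlt : r 1 < r 0 := by
      by_contra! hge
      nlinarith [Nat.mul_le_mul_left (k + 2) hge]
    have hd1 : d 0 = 1 := by
      by_contra hne
      have : 2 ≤ d 0 := by omega
      nlinarith
    rw [hd1, one_mul] at h1
    have hr0_le : r 0 ≤ (k + 2) * (rx + ry) := by nlinarith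
    have ha : a * (rx + ry) ≤ 2 * (k + 2) * (rx + ry) := by nlinarith
    exact Nat.le_of_mul_le_mul_right ha (by omega)
end

section
/- For all n ≥ 4, the number |SArith(D_n)| of smooth arithmetical structures on the bident D_n satisfies (1/24)·(n³ − 3n² − n − 45) ≤ |SArith(D_n)| < (2/3)·n³ − 2n² + (16/3)·n − 6 + (2n² − 4n + 2)·log(n − 3), where log denotes the natural logarithm. -/
/-- The type of arithmetical structures on the bident `D_n`, represented canonically:
the label functions `d, r` are required to vanish beyond index `n - 3`. -/
structure ArithOn (n : ℕ) where
  dx : ℕ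
  dy : ℕ
  d : ℕ → ℕ
  rx : ℕ
  ry : ℕ
  r : ℕ → ℕ
  arith : IsArith n dx dy d rx ry r
  d_pad : ∀ i, n - 3 < i → d i = 0
  r_pad : ∀ i, n - 3 < i → r i = 0

/-- The type of smooth arithmetical structures on the bident `D_n`, represented canonically. -/
structure SmoothArithOn (n : ℕ) where
  dx : ℕ
  dy : ℕ
  d : ℕ → ℕ
  rx : ℕ
  ry : ℕ
  r : ℕ → ℕ
  arith : IsArith n dx dy d rx ry r
  smooth : IsSmooth n dx dy d
  d_pad : ∀ i, n - 3 < i → d i = 0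
  r_pad : ∀ i, n - 3 < i → r i = 0

/-- The number of times the first entry is reduced when the subtractive Euclidean algorithm is
run on `(u, v)`. For `u, v > 0` this is the length of the Hirzebruch–Jung continued fraction
of `(u + v) / u`. -/
def hjLength (u v : ℕ) : ℕ :=
  if u = 0 ∨ v = 0 then 0
  else if v ≤ u then hjLength (u - v) v + 1
  else hjLength u (v - u)
termination_by u + v
decreasing_by all_goals omega

namespace hjLength

@[simp] lemma zero_left (v : ℕ) : hjLength 0 v = 0 := by
  rw [hjLength]; simp

lemma add_left (u : ℕ) {v : ℕ} (hv : 0 < v) : hjLength (u + v) v = hjLength u v + 1 := by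
  rw [hjLength, if_neg (by omega), if_pos (by omega), Nat.add_sub_cancel]

lemma add_right (u : ℕ) {v : ℕ} (hv : 0 < v) : hjLength u (v + u) = hjLength u v := by
  rcases Nat.eq_zero_or_pos u with rfl | hu
  · simp
  · rw [hjLength, if_neg (by omega), if_neg (by omega), Nat.add_sub_cancel]

lemma add_mul_left (u k : ℕ) {v : ℕ} (hv : 0 < v) :
    hjLength (u + k * v) v = hjLength u v + k := by
  induction k with
  | zero => simp
  | succ k ih => rw [Nat.succ_mul, ← add_assoc, add_left _ hv, ih, add_assoc]

lemma add_mul_right (u k : ℕ) {v : ℕ} (hv : 0 < v) :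
    hjLength u (v + k * u) = hjLength u v := by
  induction k with
  | zero => simp
  | succ k ih => rw [Nat.succ_mul, ← add_assoc, add_right _ (by omega), ih]

/-- Induction along the subtractive Euclidean algorithm. -/
lemma euclid_induction {P : ℕ → ℕ → Prop} (zero : ∀ v, 0 < v → P 0 v)
    (left : ∀ u v, 0 < v → P u v → P (u + v) v)
    (right : ∀ u v, 0 < u → 0 < v → P u v → P u (v + u)) (u v : ℕ) (hv : 0 < v) : P u v := by
  induction h : u + v using Nat.strong_induction_on generalizing u v with
  | _ s ih =>
    rcases Nat.eq_zero_or_pos u with rfl | hu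
    · exact zero v hv
    rcases le_or_gt v u with hvu | hvu
    · have := left (u - v) v hv (ih (u - v + v) (by omega) (u - v) v hv rfl)
      rwa [Nat.sub_add_cancel hvu] at this
    · have := right u (v - u) hu (by omega) (ih (u + (v - u)) (by omega) u (v - u) (by omega) rfl)
      rwa [Nat.sub_add_cancel hvu.le] at this

lemma pos (u v : ℕ) (hv : 0 < v) : 0 < u → 0 < hjLength u v := by
  refine euclid_induction (P := fun u v => 0 < u → 0 < hjLength u v) ?_ ?_ ?_ u v hv
  · intro v _ h; omega
  · intro u v hv _ _; rw [add_left u hv]; omega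
  · intro u v _ hv ih hu; rw [add_right u hv]; exact ih hu

lemma le_self (u v : ℕ) (hv : 0 < v) : hjLength u v ≤ u := by
  refine euclid_induction (P := fun u v => hjLength u v ≤ u) ?_ ?_ ?_ u v hv
  · simp
  · intro u v hv ih; rw [add_left u hv]; omega
  · intro u v _ hv ih; rwa [add_right u hv]

lemma le_mul (u v : ℕ) (hv : 0 < v) : u ≤ hjLength u v * v := by
  refine euclid_induction (P := fun u v => u ≤ hjLength u v * v) ?_ ?_ ?_ u v hv
  · simp
  · intro u v hv ih; rw [add_left u hv, add_mul]; omega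
  · intro u v _ hv ih; rw [add_right u hv, mul_add]; omega

lemma mul_mul (k u v : ℕ) (hk : 0 < k) (hv : 0 < v) :
    hjLength (k * u) (k * v) = hjLength u v := by
  refine euclid_induction (P := fun u v => hjLength (k * u) (k * v) = hjLength u v) ?_ ?_ ?_ u v hv
  · simp
  · intro u v hv ih; rw [mul_add, add_left _ (Nat.mul_pos hk hv), add_left _ hv, ih]
  · intro u v _ hv ih; rw [mul_add, add_right _ (Nat.mul_pos hk hv), add_right _ hv, ih]

/-- Dual Hirzebruch–Jung expansions cannot both be long. -/
lemma mul_swap_lt (u v : ℕ) (hv : 0 < v) : hjLength u v * hjLength v u < u + v := by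
  refine euclid_induction (P := fun u v => hjLength u v * hjLength v u < u + v) ?_ ?_ ?_ u v hv
  · simp
  · intro u v hv ih
    rcases Nat.eq_zero_or_pos u with rfl | hu
    · have h : hjLength (0 + v) v = 1 := by rw [add_left 0 hv]; simp
      rw [zero_add] at h ⊢
      rw [h]; omega
    · rw [add_left u hv, add_right v hu]
      have := le_self v u hu
      nlinarith
  · intro u v hu hv ih
    rw [add_left v hu, add_right u hv]
    have := le_self u v hv
    nlinarith

lemma mul_sub_add_two_le (N a t : ℕ) (ha : 0 < a) (h : a ≤ N * t) :
    hjLength (N * t - a) t + 2 ≤ N + hjLength t a := by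
  have ht : 0 < t := by
    rcases Nat.eq_zero_or_pos t with rfl | h' <;> omega
  induction N generalizing a with
  | zero => omega
  | succ N ih =>
    rcases le_or_gt a t with hat | hat
    · obtain ⟨w, rfl⟩ := Nat.exists_eq_add_of_le' hat
      have e : (N + 1) * (w + a) - a = w + N * (w + a) := by
        rw [add_mul]; omega
      rw [e, add_mul_left _ _ ht, add_left _ ha, add_comm w a, add_right _ ha]
      omega
    · obtain ⟨w, rfl⟩ := Nat.exists_eq_add_of_le' hat.le
      have e : (N + 1) * t - (w + t) = N * t - w := by
        rw [add_mul]; omega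
      rw [add_mul] at h
      rw [e, add_right _ (by omega)]
      have := ih w (by omega) (by omega)
      omega

end hjLength

/-- The number of path vertices `v_1, …, v_ℓ` in the smooth arithmetical structure with
`d_x = p` and `d_y = q`. -/
def pathLength (p q : ℕ) : ℕ := hjLength (p * q - (p + q)) (p + q)

lemma pathLength_comm (p q : ℕ) : pathLength p q = pathLength q p := by
  rw [pathLength, pathLength, mul_comm, add_comm]

lemma add_lt_mul_of_pathLength_pos {p q : ℕ} (h : 0 < pathLength p q) : p + q < p * q := by
  by_contra! hle
  rw [pathLength, Nat.sub_eq_zero_of_le hle, hjLength.zero_left] at h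
  omega

lemma two_le_of_add_lt_mul {p q : ℕ} (h : p + q < p * q) : 2 ≤ p := by
  by_contra! hp
  interval_cases p <;> omega

lemma mul_le_of_pathLength {p q : ℕ} (h : 0 < p + q) :
    p * q ≤ (pathLength p q + 1) * (p + q) := by
  have := hjLength.le_mul (p * q - (p + q)) (p + q) h
  rw [add_mul, pathLength]
  omega

lemma pathLength_add_sq (p q : ℕ) (hp : 2 ≤ p) :
    pathLength p (q + p ^ 2) = hjLength (p + q) (p ^ 2) + (p - 2) := by
  obtain ⟨k, rfl⟩ := Nat.exists_eq_add_of_le' hp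
  have e : (k + 2) * (q + (k + 2) ^ 2) =
      (k + 2 + q) + k * (k + 2 + (q + (k + 2) ^ 2)) + (k + 2 + (q + (k + 2) ^ 2)) := by ring
  rw [pathLength, e, Nat.add_sub_cancel, hjLength.add_mul_left _ _ (by omega)]
  have e' : k + 2 + (q + (k + 2) ^ 2) = (k + 2) ^ 2 + (k + 2 + q) := by ring
  rw [e', hjLength.add_right _ (by positivity), Nat.add_sub_cancel]

lemma pathLength_lt_add_sq {p q : ℕ} (h : p + q < p * q) :
    pathLength p q < pathLength p (q + p ^ 2) := by
  have hp := two_le_of_add_lt_mul h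
  obtain ⟨k, rfl⟩ := Nat.exists_eq_add_of_le' hp
  rw [pathLength_add_sq _ _ hp]
  have e : (k + 1) * (k + 2 + q) + (k + 2 + q) = (k + 2) * q + (k + 2) ^ 2 := by ring
  have := hjLength.mul_sub_add_two_le (k + 1) ((k + 2) ^ 2) (k + 2 + q) (by positivity) (by omega)
  rw [pathLength]
  have e2 : (k + 2) * q - (k + 2 + q) = (k + 1) * (k + 2 + q) - (k + 2) ^ 2 := by omega
  rw [e2]
  omega

lemma pathLength_le_add_mul_sq {p q : ℕ} (h : p + q < p * q) (k : ℕ) :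
    pathLength p q + k ≤ pathLength p (q + k * p ^ 2) := by
  induction k with
  | zero => simp
  | succ k ih =>
    have hp := two_le_of_add_lt_mul h
    have h' : p + (q + k * p ^ 2) < p * (q + k * p ^ 2) := by
      have := Nat.mul_le_mul_right (k * p ^ 2) (show 1 ≤ p by omega)
      rw [mul_add]; omega
    have := pathLength_lt_add_sq h'
    rw [Nat.succ_mul, ← add_assoc q]
    omega

lemma eq_of_pathLength_eq_of_modEq {p q q' : ℕ} (h : 0 < pathLength p q)
    (heq : pathLength p q = pathLength p q') (hmod : q % p ^ 2 = q' % p ^ 2) : q = q' := by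
  wlog hle : q ≤ q' generalizing q q'
  · exact (this (heq ▸ h) heq.symm hmod.symm (by omega)).symm
  obtain ⟨k, hk⟩ := (Nat.modEq_iff_dvd' hle).1 hmod
  have h1 := pathLength_le_add_mul_sq (add_lt_mul_of_pathLength_pos h) k
  have e : q' = q + k * p ^ 2 := by rw [mul_comm k]; omega
  rw [← e] at h1
  have : k = 0 := by omega
  subst this
  omega

/-- The pairs `(d_x, d_y)` arising from smooth structures with `ℓ` path vertices after `v_0`. -/
def smoothPairs (l : ℕ) : Set (ℕ × ℕ) := {x | pathLength x.1 x.2 = l}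

/-- A finite model into which the smooth pairs `(p, q)` with `p ≤ q` inject, where `N = ℓ + 1`. -/
def boundingFinset (N : ℕ) : Finset ((_ : ℕ) × ℕ) :=
  (Finset.Icc 2 N).sigma (fun p => Finset.range (p ^ 2)) ∪
    (Finset.Icc (N + 1) (2 * N)).sigma (fun p => Finset.Icc p (N + N ^ 2 / (p - N)))

/-- The map sending a pair to its image in `boundingFinset`. -/
def boundingMap (N : ℕ) (x : ℕ × ℕ) : (_ : ℕ) × ℕ :=
  if x.1 ≤ N then ⟨x.1, x.2 % x.1 ^ 2⟩ else ⟨x.1, x.2⟩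

lemma boundingMap_injOn {l : ℕ} (hl : 0 < l) (N : ℕ) :
    Set.InjOn (boundingMap N) (smoothPairs l) := by
  rintro ⟨p, q⟩ h ⟨p', q'⟩ h' he
  simp only [smoothPairs, Set.mem_ofPred_eq] at h h'
  have hp : p = p' := by
    have := congrArg Sigma.fst he
    simp only [boundingMap] at this
    split_ifs at this <;> exact this
  subst hp
  simp only [boundingMap] at he
  split_ifs at he
  · have he2 : q % p ^ 2 = q' % p ^ 2 := by simpa using he
    rw [eq_of_pathLength_eq_of_modEq (by omega) (h.trans h'.symm) he2]
  · have he2 : q = q' := by simpa using he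
    rw [he2]

lemma boundingMap_mem {l p q : ℕ} (hl : 0 < l) (h : (p, q) ∈ smoothPairs l) (hpq : p ≤ q) :
    boundingMap (l + 1) (p, q) ∈ boundingFinset (l + 1) := by
  simp only [smoothPairs, Set.mem_ofPred_eq] at h
  have hp := two_le_of_add_lt_mul (add_lt_mul_of_pathLength_pos (h ▸ hl))
  have hle := mul_le_of_pathLength (p := p) (q := q) (by omega)
  rw [h] at hle
  generalize l + 1 = N at hle ⊢
  unfold boundingMap boundingFinset
  split_ifs with hpN
  · simp only [Finset.mem_union, Finset.mem_sigma, Finset.mem_Icc, Finset.mem_range]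
    exact Or.inl ⟨⟨hp, hpN⟩, Nat.mod_lt _ (by positivity)⟩
  · simp only [Finset.mem_union, Finset.mem_sigma, Finset.mem_Icc, Finset.mem_range]
    simp only at hpN
    obtain ⟨j, rfl⟩ := Nat.exists_eq_add_of_le (show N ≤ p by omega)
    refine Or.inr ⟨⟨by omega, ?_⟩, hpq, ?_⟩
    · nlinarith
    · rw [Nat.add_sub_cancel_left, ← Nat.sub_le_iff_le_add', Nat.le_div_iff_mul_le (by omega),
        Nat.sub_mul, Nat.sub_le_iff_le_add]
      nlinarith

lemma sum_sq_Icc_two (N : ℕ) (hN : 1 ≤ N) :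
    (∑ p ∈ Finset.Icc 2 N, (p : ℝ) ^ 2) = N * (N + 1) * (2 * N + 1) / 6 - 1 := by
  induction N, hN using Nat.le_induction with
  | base => norm_num
  | succ N hN ih =>
    rw [Finset.sum_Icc_succ_top (by omega), ih]
    push_cast
    ring

lemma card_boundingFinset_le (N : ℕ) (hN : 1 ≤ N) :
    ((boundingFinset N).card : ℝ) ≤
      N * (N + 1) * (2 * N + 1) / 6 - 1 + N ^ 2 * (1 + Real.log N) - N * (N - 1) / 2 := by
  have h1 : (boundingFinset N).card ≤ ∑ p ∈ Finset.Icc 2 N, p ^ 2 +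
      ∑ p ∈ Finset.Icc (N + 1) (2 * N), (N + N ^ 2 / (p - N) + 1 - p) := by
    refine (Finset.card_union_le _ _).trans ?_
    simp [Finset.card_sigma]
  have h2 : ∑ p ∈ Finset.Icc (N + 1) (2 * N), (N + N ^ 2 / (p - N) + 1 - p) =
      ∑ i ∈ Finset.range N, (N + N ^ 2 / (i + 1) + 1 - (N + 1 + i)) := by
    rw [← Finset.Ico_succ_right_eq_Icc, Finset.sum_Ico_eq_sum_range]
    refine Finset.sum_congr ?_ ?_
    · congr 1; simp; omega
    · intro i _
      congr 4; omega
  have h3 : ∀ i ∈ Finset.range N, ((N + N ^ 2 / (i + 1) + 1 - (N + 1 + i) : ℕ) : ℝ) ≤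
      N ^ 2 * (i + 1 : ℝ)⁻¹ - i := by
    intro i hi
    rw [Finset.mem_range] at hi
    have hle : i ≤ N ^ 2 / (i + 1) := by
      rw [Nat.le_div_iff_mul_le (by omega)]; nlinarith
    have e : N + N ^ 2 / (i + 1) + 1 - (N + 1 + i) = N ^ 2 / (i + 1) - i := by omega
    rw [e, Nat.cast_sub hle]
    have := Nat.cast_div_le (α := ℝ) (m := N ^ 2) (n := i + 1)
    push_cast at this
    rw [div_eq_mul_inv] at this
    linarith
  have h4 := Finset.sum_le_sum h3
  rw [Finset.sum_sub_distrib, ← Finset.mul_sum] at h4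
  have h5 : (∑ i ∈ Finset.range N, (i + 1 : ℝ)⁻¹) ≤ 1 + Real.log N := by
    have := harmonic_le_one_add_log N
    simpa [harmonic] using this
  have h6 : (∑ i ∈ Finset.range N, (i : ℝ)) = N * (N - 1) / 2 := by
    have := Finset.sum_range_id_mul_two N
    have h := congrArg (fun k : ℕ => (k : ℝ)) this
    push_cast [Nat.cast_sub hN] at h
    linarith
  have h7 := sum_sq_Icc_two N hN
  have h8 : ((boundingFinset N).card : ℝ) ≤ ∑ p ∈ Finset.Icc 2 N, (p : ℝ) ^ 2 +
      ∑ i ∈ Finset.range N, ((N + N ^ 2 / (i + 1) + 1 - (N + 1 + i) : ℕ) : ℝ) := by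
    rw [h2] at h1
    exact_mod_cast h1
  have h9 := mul_le_mul_of_nonneg_left h5 (sq_nonneg (N : ℝ))
  linarith

lemma swap_mem_smoothPairs {l : ℕ} {x : ℕ × ℕ} :
    x.swap ∈ smoothPairs l ↔ x ∈ smoothPairs l := by
  simp only [smoothPairs, Set.mem_ofPred_eq, Prod.fst_swap, Prod.snd_swap]
  rw [pathLength_comm]

lemma finite_smoothPairs_le {l : ℕ} (hl : 0 < l) : {x ∈ smoothPairs l | x.1 ≤ x.2}.Finite :=
  Set.Finite.of_injOn (f := boundingMap (l + 1)) (t := (boundingFinset (l + 1) : Set _))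
    (fun _ hx => boundingMap_mem hl hx.1 hx.2)
    ((boundingMap_injOn hl _).mono fun _ hx => hx.1) (Finset.finite_toSet _)

lemma smoothPairs_eq_union (l : ℕ) :
    smoothPairs l = {x ∈ smoothPairs l | x.1 ≤ x.2} ∪
      Prod.swap '' {x ∈ smoothPairs l | x.1 ≤ x.2} := by
  ext x
  constructor
  · intro hx
    rcases le_total x.1 x.2 with h | h
    · exact Or.inl ⟨hx, h⟩
    · exact Or.inr ⟨x.swap, ⟨swap_mem_smoothPairs.2 hx, h⟩, Prod.swap_swap x⟩
  · rintro (hx | ⟨y, hy, rfl⟩)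
    · exact hx.1
    · exact swap_mem_smoothPairs.2 hy.1

lemma finite_smoothPairs {l : ℕ} (hl : 0 < l) : (smoothPairs l).Finite := by
  rw [smoothPairs_eq_union]
  exact (finite_smoothPairs_le hl).union ((finite_smoothPairs_le hl).image _)

lemma ncard_smoothPairs_le {l : ℕ} (hl : 0 < l) :
    (smoothPairs l).ncard ≤ 2 * (boundingFinset (l + 1)).card := by
  have h1 : {x ∈ smoothPairs l | x.1 ≤ x.2}.ncard ≤ (boundingFinset (l + 1)).card := by
    rw [← Set.ncard_coe_finset]
    exact Set.ncard_le_ncard_of_injOn (boundingMap (l + 1))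
      (fun _ hx => boundingMap_mem hl hx.1 hx.2)
      ((boundingMap_injOn hl _).mono fun _ hx => hx.1) (Finset.finite_toSet _)
  rw [smoothPairs_eq_union]
  refine (Set.ncard_union_le _ _).trans ?_
  rw [Set.ncard_image_of_injective _ Prod.swap_injective]
  omega

lemma ncard_smoothPairs_lt (n : ℕ) (hn : 4 ≤ n) :
    ((smoothPairs (n - 3)).ncard : ℝ) <
      2 / 3 * (n : ℝ) ^ 3 - 2 * (n : ℝ) ^ 2 + 16 / 3 * (n : ℝ) - 6 +
        (2 * (n : ℝ) ^ 2 - 4 * (n : ℝ) + 2) * Real.log ((n : ℝ) - 3) := by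
  obtain ⟨k, rfl⟩ := Nat.exists_eq_add_of_le' hn
  have h1 : ((smoothPairs (k + 1)).ncard : ℝ) ≤ 2 * (boundingFinset (k + 2)).card := by
    exact_mod_cast ncard_smoothPairs_le (l := k + 1) (by omega)
  have h2 := card_boundingFinset_le (k + 2) (by omega)
  have h3 : (k + 1 : ℝ) * (Real.log (k + 2) - Real.log (k + 1)) ≤ 1 := by
    have hk : (0 : ℝ) < k + 1 := by positivity
    rw [← Real.log_div (by positivity) (by positivity)]
    have := Real.log_le_sub_one_of_pos (show (0 : ℝ) < (k + 2) / (k + 1) by positivity)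
    have e : ((k : ℝ) + 2) / (k + 1) - 1 = 1 / (k + 1) := by field_simp; ring
    rw [e, le_div_iff₀ hk] at this
    linarith
  have h4 : 0 ≤ Real.log ((k : ℝ) + 1) := Real.log_nonneg (by linarith [k.cast_nonneg (α := ℝ)])
  have h5 : (k + 1 : ℝ) * (k + 3) * (Real.log (k + 2) - Real.log (k + 1)) ≤ k + 3 := by
    nlinarith [k.cast_nonneg (α := ℝ)]
  have e : k + 4 - 3 = k + 1 := by omega
  rw [e]
  push_cast at h2 ⊢
  have e' : (k : ℝ) + 4 - 3 = k + 1 := by ring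
  rw [e']
  nlinarith [k.cast_nonneg (α := ℝ), mul_nonneg (k.cast_nonneg (α := ℝ)) h4]

/-- Residues whose expansion is short enough to be completed to a smooth pair. -/
def shortResidues (p : ℕ) : Finset ℕ :=
  {u ∈ Finset.Ico 1 (p ^ 2) | hjLength u (p ^ 2) < p}

lemma le_two_mul_card_shortResidues (p : ℕ) : p ^ 2 ≤ 2 * (shortResidues p).card + 1 := by
  have h : Finset.Ico 1 (p ^ 2) ⊆
      shortResidues p ∪ (shortResidues p).image (fun u => p ^ 2 - u) := by
    intro u hu
    have hu' := Finset.mem_Ico.1 hu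
    obtain ⟨v, hv⟩ := Nat.exists_eq_add_of_le hu'.2.le
    have hv0 : 0 < v := by omega
    have hlt := hjLength.mul_swap_lt u v hv0
    have e1 : hjLength u (p ^ 2) = hjLength u v := by
      rw [hv, add_comm u, hjLength.add_right _ hv0]
    have e2 : hjLength v (p ^ 2) = hjLength v u := by
      rw [hv, hjLength.add_right _ hu'.1]
    rw [Finset.mem_union]
    by_cases hs : hjLength u (p ^ 2) < p
    · exact Or.inl (Finset.mem_filter.2 ⟨hu, hs⟩)
    · refine Or.inr (Finset.mem_image.2 ⟨v, Finset.mem_filter.2 ⟨Finset.mem_Ico.2 (by omega), ?_⟩,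
        by omega⟩)
      by_contra! hs2
      rw [e2] at hs2
      rw [e1] at hs
      have := Nat.mul_le_mul (not_lt.1 hs) hs2
      nlinarith
  have h1 := (Finset.card_le_card h).trans (Finset.card_union_le _ _)
  have h2 := Finset.card_image_le (s := shortResidues p) (f := fun u => p ^ 2 - u)
  rw [Nat.card_Ico] at h1
  omega

lemma exists_mem_smoothPairs {n p u : ℕ} (hp : 2 ≤ p) (hpn : p ≤ n / 2)
    (hu : u ∈ shortResidues p) :
    ∃ q, p < q ∧ (p, q) ∈ smoothPairs (n - 3) ∧ (p + q) % p ^ 2 = u := by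
  obtain ⟨hu1, hu2⟩ := Finset.mem_filter.1 hu
  rw [Finset.mem_Ico] at hu1
  obtain ⟨c, hc⟩ := Nat.exists_eq_add_of_le (show hjLength u (p ^ 2) + p + 1 ≤ n by omega)
  have hpp : 2 * p ≤ p ^ 2 := by nlinarith
  have h0 : 0 < p ^ 2 := by omega
  rcases Nat.eq_zero_or_pos c with rfl | hc0
  · refine ⟨p ^ 2 + u - p, by omega, ?_, ?_⟩
    · have e : p * (p ^ 2 + u - p) - (p + (p ^ 2 + u - p)) = u + (p - 2) * (p ^ 2 + u) := by
        obtain ⟨k, rfl⟩ := Nat.exists_eq_add_of_le' hp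
        have e1 : k + 2 + ((k + 2) ^ 2 + u - (k + 2)) = (k + 2) ^ 2 + u := by omega
        rw [e1, Nat.mul_sub, Nat.sub_sub, Nat.sub_eq_iff_eq_add]
        · simp only [Nat.add_sub_cancel]; ring
        · nlinarith [Nat.zero_le k, Nat.zero_le u]
      have e1 : p + (p ^ 2 + u - p) = p ^ 2 + u := by omega
      rw [smoothPairs, Set.mem_ofPred_eq, pathLength, e, e1, hjLength.add_mul_left _ _ (by omega),
        hjLength.add_right _ h0]
      omega
    · have e1 : p + (p ^ 2 + u - p) = u + p ^ 2 := by omega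
      rw [e1, Nat.add_mod_right, Nat.mod_eq_of_lt hu1.2]
  · obtain ⟨c, rfl⟩ := Nat.exists_eq_add_of_le' hc0
    have hq : p ≤ c * p ^ 2 + p ^ 2 + u := by nlinarith
    refine ⟨c * p ^ 2 + p ^ 2 + u - p + p ^ 2, by omega, ?_, ?_⟩
    · have e1 : p + (c * p ^ 2 + p ^ 2 + u - p) = u + (c + 1) * p ^ 2 := by
        rw [add_mul]; omega
      rw [smoothPairs, Set.mem_ofPred_eq, pathLength_add_sq _ _ hp, e1,
        hjLength.add_mul_left _ _ h0]
      omega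
    · have e1 : p + (c * p ^ 2 + p ^ 2 + u - p + p ^ 2) = u + (c + 2) * p ^ 2 := by
        rw [add_mul]; omega
      rw [e1, Nat.add_mul_mod_self_right, Nat.mod_eq_of_lt hu1.2]

lemma sum_card_shortResidues_le {n : ℕ} (hn : 4 ≤ n) :
    2 * ∑ p ∈ Finset.Icc 2 (n / 2), (shortResidues p).card ≤ (smoothPairs (n - 3)).ncard := by
  classical
  set A := {x ∈ smoothPairs (n - 3) | x.1 < x.2} with hA
  have hfin := finite_smoothPairs (l := n - 3) (by omega)
  have hAfin : A.Finite := hfin.subset fun _ hx => hx.1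
  have h1 : ∑ p ∈ Finset.Icc 2 (n / 2), (shortResidues p).card ≤ A.ncard := by
    rw [← Finset.card_sigma, ← Set.ncard_coe_finset]
    have hex : ∀ x : (_ : ℕ) × ℕ, x ∈ (Finset.Icc 2 (n / 2)).sigma shortResidues →
        ∃ q, x.1 < q ∧ (x.1, q) ∈ smoothPairs (n - 3) ∧ (x.1 + q) % x.1 ^ 2 = x.2 := by
      intro x hx
      rw [Finset.mem_sigma, Finset.mem_Icc] at hx
      exact exists_mem_smoothPairs hx.1.1 hx.1.2 hx.2
    choose! q hq using hex
    refine Set.ncard_le_ncard_of_injOn (fun x => (x.1, q x)) ?_ ?_ hAfin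
    · intro x hx
      exact ⟨(hq x hx).2.1, (hq x hx).1⟩
    · rintro ⟨p, u⟩ hx ⟨p', u'⟩ hy he
      simp only [Prod.mk.injEq] at he
      obtain ⟨rfl, he⟩ := he
      have h2 := (hq _ hx).2.2
      have h3 := (hq _ hy).2.2
      rw [← he] at h3
      simp only at h2 h3
      rw [← h2, ← h3]
  have hdisj : Disjoint A (Prod.swap '' A) := by
    rw [Set.disjoint_left]
    rintro x hx ⟨y, hy, rfl⟩
    have h2 : y.2 < y.1 := hx.2
    have h3 : y.1 < y.2 := hy.2
    omega
  have hsub : A ∪ Prod.swap '' A ⊆ smoothPairs (n - 3) := by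
    rintro x (hx | ⟨y, hy, rfl⟩)
    · exact hx.1
    · exact swap_mem_smoothPairs.2 hy.1
  have h2 := Set.ncard_le_ncard hsub hfin
  rw [Set.ncard_union_eq hdisj hAfin (hAfin.image _),
    Set.ncard_image_of_injective _ Prod.swap_injective] at h2
  omega

lemma le_ncard_smoothPairs (n : ℕ) (hn : 4 ≤ n) :
    ((n : ℝ) ^ 3 - 3 * (n : ℝ) ^ 2 - (n : ℝ) - 45) / 24 ≤ ((smoothPairs (n - 3)).ncard : ℝ) := by
  have h1 : ∑ p ∈ Finset.Icc 2 (n / 2), ((p : ℝ) ^ 2 - 1) ≤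
      ((smoothPairs (n - 3)).ncard : ℝ) := by
    have h := sum_card_shortResidues_le hn
    rw [Finset.mul_sum] at h
    have h' : ∑ p ∈ Finset.Icc 2 (n / 2), (2 * (shortResidues p).card : ℝ) ≤
        ((smoothPairs (n - 3)).ncard : ℝ) := by exact_mod_cast h
    refine (Finset.sum_le_sum fun p _ => ?_).trans h'
    have : ((p ^ 2 : ℕ) : ℝ) ≤ ((2 * (shortResidues p).card + 1 : ℕ) : ℝ) :=
      Nat.cast_le.2 (le_two_mul_card_shortResidues p)
    push_cast at this
    linarith
  refine le_trans ?_ h1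
  rw [Finset.sum_sub_distrib, sum_sq_Icc_two _ (by omega)]
  simp only [Finset.sum_const, Nat.card_Icc, nsmul_eq_mul, mul_one]
  obtain ⟨h, rfl | rfl⟩ := Nat.even_or_odd' n
  · have e : 2 * h / 2 = h := by omega
    rw [e, Nat.cast_sub (by omega)]
    push_cast
    have : (2 : ℝ) ≤ h := by exact_mod_cast (show 2 ≤ h by omega)
    nlinarith
  · have e : (2 * h + 1) / 2 = h := by omega
    rw [e, Nat.cast_sub (by omega)]
    push_cast
    have : (2 : ℝ) ≤ h := by exact_mod_cast (show 2 ≤ h by omega)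
    nlinarith

/-- The sequence `r 0 > r 1 > ⋯ > r ℓ > 0 = r (ℓ + 1) = ⋯` with each interior entry dividing the
sum of its neighbours. -/
structure IsHJChain (l : ℕ) (r : ℕ → ℕ) : Prop where
  pad : ∀ i, l < i → r i = 0
  lt : ∀ i, i ≤ l → r (i + 1) < r i
  dvd : ∀ i, i < l → r (i + 1) ∣ r i + r (i + 2)

namespace IsHJChain

lemma tail {l : ℕ} {r : ℕ → ℕ} (h : IsHJChain (l + 1) r) : IsHJChain l (fun i => r (i + 1)) where
  pad i hi := h.pad (i + 1) (by omega)
  lt i hi := h.lt (i + 1) (by omega)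
  dvd i hi := h.dvd (i + 1) (by omega)

lemma pos {l : ℕ} {r : ℕ → ℕ} (h : IsHJChain l r) {i : ℕ} (hi : i ≤ l) : 0 < r i :=
  (Nat.zero_le _).trans_lt (h.lt i hi)

lemma hjLength_step {a b c : ℕ} (hba : b < a) (hcb : c < b) (hd : b ∣ a + c) :
    hjLength b (a - b) = hjLength c (b - c) + 1 := by
  obtain ⟨d, hd⟩ := hd
  have hd2 : 2 ≤ d := by
    by_contra! hlt
    interval_cases d <;> omega
  obtain ⟨k, rfl⟩ := Nat.exists_eq_add_of_le' hd2
  have e : a - b = (b - c) + k * b := by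
    rw [mul_add, mul_comm b k] at hd; omega
  rw [e, hjLength.add_mul_right _ _ (by omega)]
  conv_lhs => rw [show b = c + (b - c) by omega]
  rw [show c + (b - c) - c = b - c by omega, hjLength.add_left _ (by omega)]

lemma hjLength_eq {l : ℕ} {r : ℕ → ℕ} (h : IsHJChain l r) : hjLength (r 1) (r 0 - r 1) = l := by
  induction l generalizing r with
  | zero => rw [h.pad 1 (by omega)]; simp
  | succ l ih =>
    rw [hjLength_step (h.lt 0 (by omega)) (h.lt 1 (by omega)) (h.dvd 0 (by omega))]
    simpa using ih h.tail

lemma eq_of_dvd_add {a b c c' : ℕ} (hc : c < b) (hc' : c' < b) (h : b ∣ a + c)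
    (h' : b ∣ a + c') : c = c' := by
  have : a + c ≡ a + c' [MOD b] :=
    ((Nat.modEq_zero_iff_dvd).2 h).trans ((Nat.modEq_zero_iff_dvd).2 h').symm
  exact (Nat.ModEq.add_left_cancel' a this).eq_of_lt_of_lt hc hc'

lemma eq_of_eq {l : ℕ} {r r' : ℕ → ℕ} (h : IsHJChain l r) (h' : IsHJChain l r') (h0 : r 0 = r' 0)
    (h1 : r 1 = r' 1) : r = r' := by
  induction l generalizing r r' with
  | zero =>
    funext i
    rcases Nat.eq_zero_or_pos i with rfl | hi
    · exact h0
    · rw [h.pad i hi, h'.pad i hi]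
  | succ l ih =>
    have h2 : r 2 = r' 2 := by
      refine eq_of_dvd_add (a := r 0) (h.lt 1 (by omega)) ?_ (h.dvd 0 (by omega)) ?_
      · rw [h1]; exact h'.lt 1 (by omega)
      · rw [h1, h0]; exact h'.dvd 0 (by omega)
    have := ih h.tail h'.tail h1 h2
    funext i
    cases i with
    | zero => exact h0
    | succ i => exact congrFun this i

lemma exists_of_hjLength_eq {l a b : ℕ} (hba : b < a) (h : hjLength b (a - b) = l) :
    ∃ r, IsHJChain l r ∧ r 0 = a ∧ r 1 = b := by
  induction l generalizing a b with
  | zero =>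
    have hb : b = 0 := by
      by_contra hb
      have := hjLength.pos b (a - b) (by omega) (by omega)
      omega
    subst hb
    refine ⟨fun i => if i = 0 then a else 0, ⟨?_, ?_, ?_⟩, by simp, by simp⟩
    · intro i hi; simp; omega
    · intro i hi
      obtain rfl : i = 0 := by omega
      simpa using hba
    · intro i hi; omega
  | succ l ih =>
    have hb : 0 < b := by
      rcases Nat.eq_zero_or_pos b with rfl | hb
      · simp at h
      · exact hb
    obtain ⟨c, hcb, hd⟩ : ∃ c, c < b ∧ b ∣ a + c := by
      refine ⟨(b - a % b) % b, Nat.mod_lt _ hb, ?_⟩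
      rw [Nat.dvd_iff_mod_eq_zero, Nat.add_mod_mod, ← Nat.mod_add_mod,
        Nat.add_sub_cancel' (Nat.mod_lt a hb).le, Nat.mod_self]
    rw [hjLength_step hba hcb hd] at h
    obtain ⟨r, hr, h0, h1⟩ := ih hcb (by omega)
    refine ⟨fun i => Nat.casesOn i a r, ⟨?_, ?_, ?_⟩, rfl, h0⟩
    · rintro (_ | i) hi
      · omega
      · exact hr.pad i (by omega)
    · rintro (_ | i) hi
      · simpa [h0] using hba
      · exact hr.lt i (by omega)
    · rintro (_ | i) hi
      · simpa [h0, h1] using hd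
      · exact hr.dvd i (by omega)

lemma dvd_of_dvd {l c : ℕ} {r : ℕ → ℕ} (h : IsHJChain l r) (h0 : c ∣ r 0) (h1 : c ∣ r 1) (i : ℕ) :
    c ∣ r i ∧ c ∣ r (i + 1) := by
  induction i with
  | zero => exact ⟨h0, h1⟩
  | succ i ih =>
    refine ⟨ih.2, ?_⟩
    rcases lt_or_ge i l with hi | hi
    · exact (Nat.dvd_add_right ih.1).1 (ih.2.trans (h.dvd i hi))
    · rw [h.pad _ (by omega)]; exact dvd_zero c

end IsHJChain

namespace SmoothArithOn

variable {n : ℕ}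

lemma mul_r_eq (s : SmoothArithOn n) {i : ℕ} (hi : i + 1 ≤ n - 3) :
    s.d (i + 1) * s.r (i + 1) = s.r i + s.r (i + 2) := by
  obtain ⟨-, -, -, -, -, -, -, -, -, -, -, hmid, hend, -⟩ := s.arith
  rcases Nat.lt_or_ge (i + 1) (n - 3) with h | h
  · exact hmid (i + 1) (by omega) (by omega)
  · have e : n - 3 = i + 1 := by omega
    have := hend (by omega)
    rw [e] at this
    rw [this, s.r_pad (i + 2) (by omega)]
    rfl

lemma isHJChain (s : SmoothArithOn n) : IsHJChain (n - 3) s.r where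
  pad := s.r_pad
  dvd i hi := ⟨s.d (i + 1), by rw [← mul_r_eq s hi, mul_comm]⟩
  lt i hi := by
    obtain ⟨-, -, -, -, -, -, hr, -⟩ := s.arith
    induction hi using Nat.decreasingInduction with
    | self =>
      rw [s.r_pad _ (by omega)]
      exact hr _ le_rfl
    | of_succ k hk ih =>
      have h1 := mul_r_eq s (i := k) hk
      have h2 := s.smooth.2.2 (k + 1) (by omega) hk
      have h3 := Nat.mul_le_mul_right (s.r (k + 1)) h2
      have ih' : s.r (k + 2) < s.r (k + 1) := ih
      omega

lemma r_zero_eq (hn : 4 ≤ n) (s : SmoothArithOn n) : s.d 0 = 1 ∧ s.r 0 = s.rx + s.ry + s.r 1 := by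
  have hlt := (s.isHJChain).lt 0 (by omega)
  obtain ⟨hx2, hy2, -⟩ := s.smooth
  obtain ⟨-, -, -, hd, -, -, hr, hx, hy, h0, -⟩ := s.arith
  have h0 := h0 (by omega)
  have hx' := Nat.mul_le_mul_right s.rx hx2
  have hy' := Nat.mul_le_mul_right s.ry hy2
  have hd0 := hd 0 (by omega)
  have h1 : s.d 0 = 1 := by
    by_contra hne
    have := Nat.mul_le_mul_right (s.r 0) (show 2 ≤ s.d 0 by omega)
    rw [zero_add] at hlt
    omega
  rw [h1, one_mul] at h0
  exact ⟨h1, h0⟩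

lemma coprime (hn : 4 ≤ n) (s : SmoothArithOn n) : Nat.Coprime s.rx s.ry := by
  have h0 := (r_zero_eq hn s).2
  have hc := s.isHJChain
  obtain ⟨-, -, -, -, -, -, -, hx, -, -, -, -, -, hgcd⟩ := s.arith
  refine hgcd _ (Nat.gcd_dvd_left _ _) (Nat.gcd_dvd_right _ _) fun i _ => ?_
  have hr0 : Nat.gcd s.rx s.ry ∣ s.r 0 := hx ▸ (Nat.gcd_dvd_left _ _).mul_left _
  refine (hc.dvd_of_dvd hr0 ?_ i).1
  rw [h0] at hr0
  exact (Nat.dvd_add_right (dvd_add (Nat.gcd_dvd_left _ _) (Nat.gcd_dvd_right _ _))).1 hr0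

lemma rx_mul_gcd (hn : 4 ≤ n) (s : SmoothArithOn n) :
    s.rx * Nat.gcd s.dx s.dy = s.dy ∧ s.ry * Nat.gcd s.dx s.dy = s.dx := by
  have hco := coprime hn s
  obtain ⟨-, -, -, -, hrx, hry, -, hx, hy, -⟩ := s.arith
  have he : s.dx * s.rx = s.dy * s.ry := hx.trans hy.symm
  obtain ⟨k, hk⟩ : s.rx ∣ s.dy := hco.dvd_of_dvd_mul_right (he ▸ Dvd.intro_left _ rfl)
  have hk' : s.dx = s.ry * k := by
    refine Nat.eq_of_mul_eq_mul_right hrx ?_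
    rw [he, hk]; ring
  have hg : Nat.gcd s.dx s.dy = k := by
    rw [hk, hk', Nat.gcd_mul_right, hco.symm.gcd_eq_one, one_mul]
  rw [hg]
  exact ⟨hk.symm, hk'.symm⟩

lemma mem_smoothPairs (hn : 4 ≤ n) (s : SmoothArithOn n) : (s.dx, s.dy) ∈ smoothPairs (n - 3) := by
  have hlen := (s.isHJChain).hjLength_eq
  obtain ⟨h1, h2⟩ := rx_mul_gcd hn s
  have h0 := (r_zero_eq hn s).2
  obtain ⟨-, hdx, -, -, hrx, -, -, hx, -⟩ := s.arith
  have hk : 0 < Nat.gcd s.dx s.dy := Nat.gcd_pos_of_pos_left _ hdx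
  generalize Nat.gcd s.dx s.dy = k at *
  have e1 : s.dx + s.dy = k * (s.r 0 - s.r 1) := by
    rw [h0, Nat.add_sub_cancel, ← h1, ← h2]; ring
  have e2 : s.dx * s.dy = k * s.r 1 + (s.dx + s.dy) := by
    calc s.dx * s.dy = k * s.r 0 := by rw [← hx, ← h1]; ring
      _ = _ := by rw [h0, ← h1, ← h2]; ring
  change pathLength s.dx s.dy = n - 3
  rw [pathLength, e2, Nat.add_sub_cancel, e1, hjLength.mul_mul _ _ _ hk (by omega), hlen]

lemma injective (hn : 4 ≤ n) :
    Function.Injective (fun s : SmoothArithOn n => (s.dx, s.dy)) := by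
  intro s t h
  obtain ⟨hx, hy⟩ := Prod.mk.inj h
  have hs := rx_mul_gcd hn s
  have ht := rx_mul_gcd hn t
  have hk : 0 < Nat.gcd s.dx s.dy := Nat.gcd_pos_of_pos_left _ s.arith.2.1
  rw [← hx, ← hy] at ht
  have hrx : s.rx = t.rx := Nat.eq_of_mul_eq_mul_right hk (hs.1.trans ht.1.symm)
  have hry : s.ry = t.ry := Nat.eq_of_mul_eq_mul_right hk (hs.2.trans ht.2.symm)
  have hs0 := r_zero_eq hn s
  have ht0 := r_zero_eq hn t
  have hr0 : s.r 0 = t.r 0 := by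
    obtain ⟨-, -, -, -, -, -, -, h1, -⟩ := s.arith
    obtain ⟨-, -, -, -, -, -, -, h2, -⟩ := t.arith
    rw [← h1, ← h2, hx, hrx]
  have hr : s.r = t.r := (s.isHJChain).eq_of_eq (t.isHJChain) hr0 (by omega)
  have hd : s.d = t.d := by
    funext i
    rcases lt_or_ge (n - 3) i with hi | hi
    · rw [s.d_pad i hi, t.d_pad i hi]
    cases i with
    | zero => rw [hs0.1, ht0.1]
    | succ i =>
      refine Nat.eq_of_mul_eq_mul_right ((s.isHJChain).pos hi) ?_
      rw [mul_r_eq s hi, hr, mul_r_eq t hi]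
  cases s
  cases t
  simp_all

lemma exists_of_mem_smoothPairs (hn : 4 ≤ n) {p q : ℕ} (h : (p, q) ∈ smoothPairs (n - 3)) :
    ∃ s : SmoothArithOn n, (s.dx, s.dy) = (p, q) := by
  change pathLength p q = n - 3 at h
  have hlt : p + q < p * q := add_lt_mul_of_pathLength_pos (by omega)
  have hp : 2 ≤ p := two_le_of_add_lt_mul hlt
  have hq : 2 ≤ q := two_le_of_add_lt_mul (p := q) (q := p) (by rwa [add_comm, mul_comm])
  obtain ⟨k, y, x, hk, hco, hpk, hqk⟩ :=
    Nat.exists_coprime' (Nat.gcd_pos_of_pos_left q (by omega : 0 < p))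
  have hy : 0 < y := by
    rcases Nat.eq_zero_or_pos y with rfl | h'
    · omega
    · exact h'
  have hx : 0 < x := by
    rcases Nat.eq_zero_or_pos x with rfl | h'
    · omega
    · exact h'
  have e0 : p * q = k * (p * x) := by rw [hqk]; ring
  have e1 : p + q = k * (x + y) := by rw [hpk, hqk]; ring
  have hlt' : x + y < p * x := by
    rw [e0, e1] at hlt
    exact lt_of_mul_lt_mul_left hlt (Nat.zero_le k)
  rw [pathLength, e0, e1, ← Nat.mul_sub, hjLength.mul_mul _ _ _ hk (by omega)] at h
  obtain ⟨r, hr, hr0, hr1⟩ := IsHJChain.exists_of_hjLength_eq (l := n - 3) (a := p * x)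
    (b := p * x - (x + y)) (by omega) (by rw [Nat.sub_sub_self hlt'.le]; exact h)
  have hdvd : ∀ i, i + 1 ≤ n - 3 → (r i + r (i + 2)) / r (i + 1) * r (i + 1) =
      r i + r (i + 2) := fun i hi => Nat.div_mul_cancel (hr.dvd i hi)
  have htwo : ∀ i, i + 1 ≤ n - 3 → 2 ≤ (r i + r (i + 2)) / r (i + 1) := by
    intro i hi
    have h1 := hdvd i hi
    have h2 := hr.lt i (by omega)
    by_contra! hlt2
    have := hr.pos (i := i + 1) hi
    interval_cases (r i + r (i + 2)) / r (i + 1)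
    · omega
    · have h3 := Nat.le_of_dvd (by omega) (hr.dvd i hi)
      omega
  refine ⟨{
    dx := p, dy := q, rx := x, ry := y, r := r
    d := fun i => if n - 3 < i then 0 else if i = 0 then 1 else
      (r (i - 1) + r (i + 1)) / r i
    arith := ⟨by omega, by omega, by omega, ?_, hx, hy, fun i hi => hr.pos hi, hr0.symm, ?_, ?_, ?_,
      ?_, ?_, ?_⟩
    smooth := ⟨hp, hq, ?_⟩
    d_pad := ?_
    r_pad := hr.pad }, rfl⟩
  · rintro (_ | i) hi
    · simp
    · have := htwo i hi
      simp only [if_neg (not_lt.2 hi), Nat.add_sub_cancel, Nat.succ_ne_zero, if_false]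
      exact Nat.zero_lt_two.trans_le this
  · rw [hr0, hpk, hqk]; ring
  · intro _
    simp only [Nat.not_lt_zero, if_false, if_true]
    omega
  · intro h'; omega
  · rintro (_ | i) hi hi'
    · omega
    · simpa [not_lt.2 (show i + 1 ≤ n - 3 by omega)] using hdvd i (by omega)
  · intro _
    obtain ⟨m, hm⟩ := Nat.exists_eq_add_of_le' (show 1 ≤ n - 3 by omega)
    rw [hm]
    have h1 := hdvd m (by omega)
    have h2 := hr.pad (m + 2) (by omega)
    rw [h2] at h1
    simpa [h2] using h1
  · intro c hcx hcy _
    exact Nat.dvd_one.1 (hco ▸ Nat.dvd_gcd hcy hcx)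
  · rintro (_ | i) hi hi'
    · omega
    · simpa [not_lt.2 hi'] using htwo i hi'
  · intro i hi
    simp [hi]

lemma card_eq (hn : 4 ≤ n) : Nat.card (SmoothArithOn n) = (smoothPairs (n - 3)).ncard := by
  rw [← Set.ncard_univ, ← Set.ncard_image_of_injective _ (injective hn)]
  congr 1
  ext ⟨p, q⟩
  constructor
  · rintro ⟨s, -, h⟩
    exact h ▸ mem_smoothPairs hn s
  · intro h
    obtain ⟨s, hs⟩ := exists_of_mem_smoothPairs hn h
    exact ⟨s, trivial, hs⟩

end SmoothArithOn

/-- **Theorem 4.1.**  For all `n ≥ 4`, the number of smooth arithmetical structures on the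
bident `D_n` satisfies
`(1/24)(n³ - 3n² - n - 45) ≤ |SArith(D_n)| < (2/3)n³ - 2n² + (16/3)n - 6 + (2n² - 4n + 2)·log(n - 3)`,
where `log` is the natural logarithm. -/
theorem smooth_count_bounds (n : ℕ) (hn : 4 ≤ n) :
    ((n : ℝ) ^ 3 - 3 * (n : ℝ) ^ 2 - (n : ℝ) - 45) / 24 ≤ (Nat.card (SmoothArithOn n) : ℝ) ∧
    (Nat.card (SmoothArithOn n) : ℝ) <
      2 / 3 * (n : ℝ) ^ 3 - 2 * (n : ℝ) ^ 2 + 16 / 3 * (n : ℝ) - 6 +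
        (2 * (n : ℝ) ^ 2 - 4 * (n : ℝ) + 2) * Real.log ((n : ℝ) - 3) := by
  rw [SmoothArithOn.card_eq hn]
  exact ⟨le_ncard_smoothPairs n hn, ncard_smoothPairs_lt n hn⟩
end

section
/- Suppose x = q₁·y + r₁ and y = q₂·r₁ + r₂, where x, y, and r₁ are positive integers and q₁, q₂, and r₂ are nonnegative integers. Then F(x, y) = q₂ + F(r₁, r₂). -/
theorem F_mul_add_left (k x y : ℕ) : F (k * y + x) y = F x y := by
  rw [F, F.eq_def x y, Nat.mul_add_mod']

theorem F_add_right {x : ℕ} (hx : 0 < x) (y : ℕ) : F x (x + y) = 1 + F x y := by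
  rw [F, dif_neg (by omega)]
  congr 1
  rcases Nat.eq_zero_or_pos y with rfl | hy
  · rw [F, F.eq_def x 0]
    simp
  · rw [Nat.mod_eq_of_lt (show x < x + y by omega), Nat.add_sub_cancel_left,
      Nat.mod_eq_of_lt (by omega)]
    simpa [add_comm] using F_mul_add_left 1 x y

theorem F_mul_add_right {x : ℕ} (hx : 0 < x) (k y : ℕ) : F x (k * x + y) = k + F x y := by
  induction k with
  | zero => simp
  | succ k ih =>
    rw [show (k + 1) * x + y = x + (k * x + y) by ring, F_add_right hx, ih]
    ring

/-- **Lemma 4.4.**  Suppose `x = q₁·y + r₁` and `y = q₂·r₁ + r₂`, where `x`, `y`, `r₁` are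
positive integers and `q₁`, `q₂`, `r₂` are nonnegative integers.  Then
`F(x, y) = q₂ + F(r₁, r₂)`. -/
theorem F_euclidean_step (x y r₁ q₁ q₂ r₂ : ℕ) (hx : 0 < x) (hy : 0 < y) (hr₁ : 0 < r₁)
    (h₁ : x = q₁ * y + r₁) (h₂ : y = q₂ * r₁ + r₂) :
    F x y = q₂ + F r₁ r₂ := by
  rw [h₁, F_mul_add_left, h₂, F_mul_add_right hr₁]
end

section
/- Let k ≥ 2 and let q₁, …, q_k be positive integers. For 1 ≤ j ≤ k, let A_j denote the (1,1) entry of the 2×2 matrix product ∏_{i=1}^{j} [[q_i, 1], [1, 0]], and for 1 ≤ j ≤ k write S^o_j = Σ_{i odd, 1 ≤ i ≤ j} q_i and S^e_j = Σ_{i even, 1 ≤ i ≤ j} q_i. Then: (a) if k is even, A_k ≥ S^o_{k−1}·S^e_k + 1; (b) if k is odd, A_k ≥ S^o_k + q_k·(S^o_{k−2}·S^e_{k−1}). -/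
/-- `Aval q j` is the `(1,1)` entry of the ordered matrix product
`[[q 1, 1],[1, 0]] * [[q 2, 1],[1, 0]] * ⋯ * [[q j, 1],[1, 0]]`. -/
def Aval (q : ℕ → ℕ) (j : ℕ) : ℕ :=
  (((List.range j).map fun i => !![q (i + 1), 1; 1, 0]).prod) 0 0

/-- `Sodd q j = ∑_{i odd, 1 ≤ i ≤ j} q i`. -/
def Sodd (q : ℕ → ℕ) (j : ℕ) : ℕ := ∑ i ∈ (Finset.Icc 1 j).filter (fun i => Odd i), q i

/-- `Seven q j = ∑_{i even, 1 ≤ i ≤ j} q i`. -/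
def Seven (q : ℕ → ℕ) (j : ℕ) : ℕ := ∑ i ∈ (Finset.Icc 1 j).filter (fun i => Even i), q i

theorem Aval_add_two (q : ℕ → ℕ) (j : ℕ) :
    Aval q (j + 2) = q (j + 2) * Aval q (j + 1) + Aval q j := by
  simp [Aval, List.range_succ, List.prod_append, Matrix.mul_apply, Fin.sum_univ_two]
  ring

theorem Sodd_succ (q : ℕ → ℕ) (j : ℕ) :
    Sodd q (j + 1) = Sodd q j + if Odd (j + 1) then q (j + 1) else 0 := by
  simp only [Sodd, Finset.sum_filter]
  exact Finset.sum_Icc_succ_top (by omega) _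

theorem Seven_succ (q : ℕ → ℕ) (j : ℕ) :
    Seven q (j + 1) = Seven q j + if Even (j + 1) then q (j + 1) else 0 := by
  simp only [Seven, Finset.sum_filter]
  exact Finset.sum_Icc_succ_top (by omega) _

theorem Sodd_two_mul_add_one (q : ℕ → ℕ) (m : ℕ) :
    Sodd q (2 * m + 1) = Sodd q (2 * m) + q (2 * m + 1) := by
  rw [Sodd_succ, if_pos ⟨m, rfl⟩]

theorem Sodd_two_mul_add_two (q : ℕ → ℕ) (m : ℕ) :
    Sodd q (2 * m + 2) = Sodd q (2 * m + 1) := by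
  rw [Sodd_succ, if_neg (by grind), add_zero]

theorem Seven_two_mul_add_two (q : ℕ → ℕ) (m : ℕ) :
    Seven q (2 * m + 2) = Seven q (2 * m) + q (2 * m + 2) := by
  rw [Seven_succ, Seven_succ, if_neg (by grind), if_pos (by grind), add_zero]

theorem Sodd_pos_or_Seven_eq_zero (q : ℕ → ℕ) (m : ℕ)
    (hq : ∀ i, 1 ≤ i → i ≤ 2 * m → 0 < q i) :
    0 < Sodd q (2 * m) ∨ Seven q (2 * m) = 0 := by
  cases m with
  | zero => simp [Seven]
  | succ m =>
    left
    have := hq (2 * m + 1) (by omega) (by omega)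
    rw [mul_add, mul_one, Sodd_two_mul_add_two, Sodd_two_mul_add_one]
    omega

theorem Aval_two_mul_lower_bounds (q : ℕ → ℕ) (m : ℕ)
    (hq : ∀ i, 1 ≤ i → i ≤ 2 * m → 0 < q i) :
    Sodd q (2 * m) * Seven q (2 * m) + 1 ≤ Aval q (2 * m) ∧
    Sodd q (2 * m + 1) + q (2 * m + 1) * (Sodd q (2 * m) * Seven q (2 * m)) ≤
      Aval q (2 * m + 1) := by
  induction m with
  | zero => simp [Sodd, Seven, Aval, Finset.sum_filter]
  | succ m ih =>
    have hpos : ∀ i, 1 ≤ i → i ≤ 2 * m → 0 < q i := fun i h1 h2 => hq i h1 (by omega)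
    obtain ⟨heven, hodd⟩ := ih hpos
    have he := hq (2 * m + 2) (by omega) (by omega)
    have key : Sodd q (2 * m + 2) * Seven q (2 * m + 2) + 1 ≤ Aval q (2 * m + 2) := by
      rw [Aval_add_two, Sodd_two_mul_add_two, Seven_two_mul_add_two]
      rw [Sodd_two_mul_add_one] at hodd ⊢
      have hle : q (2 * m + 1) * Seven q (2 * m) ≤
          q (2 * m + 2) * (q (2 * m + 1) * (Sodd q (2 * m) * Seven q (2 * m))) := by
        rcases Sodd_pos_or_Seven_eq_zero q m hpos with h | h
        · calc q (2 * m + 1) * Seven q (2 * m)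
              = 1 * (q (2 * m + 1) * (1 * Seven q (2 * m))) := by ring
            _ ≤ _ := by gcongr <;> omega
        · simp [h]
      nlinarith [Nat.mul_le_mul_left (q (2 * m + 2)) hodd]
    refine ⟨key, ?_⟩
    have hrec : Aval q (2 * (m + 1) + 1) =
        q (2 * (m + 1) + 1) * Aval q (2 * m + 2) + Aval q (2 * m + 1) := Aval_add_two q _
    rw [hrec, Sodd_two_mul_add_one, show 2 * (m + 1) = 2 * m + 2 by ring]
    have hprev : Sodd q (2 * m + 2) ≤ Aval q (2 * m + 1) := by
      rw [Sodd_two_mul_add_two]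
      exact le_trans (Nat.le_add_right _ _) hodd
    nlinarith [Nat.mul_le_mul_left (q (2 * m + 2 + 1)) key]


/-- **Lemma 4.6.**  Let `k ≥ 2` and let `q₁, …, q_k` be positive integers.  With
`A_j` the `(1,1)` entry of `∏_{i=1}^{j} [[q_i, 1],[1, 0]]`:
(a) if `k` is even, then `A_k ≥ S^o_{k-1} · S^e_k + 1`;
(b) if `k` is odd, then `A_k ≥ S^o_k + q_k · (S^o_{k-2} · S^e_{k-1})`. -/
theorem Aval_lower_bounds (k : ℕ) (hk : 2 ≤ k) (q : ℕ → ℕ)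
    (hq : ∀ i, 1 ≤ i → i ≤ k → 0 < q i) :
    (Even k → Sodd q (k - 1) * Seven q k + 1 ≤ Aval q k) ∧
    (Odd k → Sodd q k + q k * (Sodd q (k - 2) * Seven q (k - 1)) ≤ Aval q k) := by
  constructor
  · rintro ⟨n, rfl⟩
    obtain ⟨m, rfl⟩ : ∃ m, n = m + 1 := ⟨n - 1, by omega⟩
    rw [show m + 1 + (m + 1) = 2 * m + 2 by ring] at hq ⊢
    rw [show 2 * m + 2 - 1 = 2 * m + 1 from rfl, ← Sodd_two_mul_add_two]
    exact (Aval_two_mul_lower_bounds q (m + 1) hq).1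
  · rintro ⟨n, rfl⟩
    obtain ⟨m, rfl⟩ : ∃ m, n = m + 1 := ⟨n - 1, by omega⟩
    rw [show 2 * (m + 1) + 1 - 2 = 2 * m + 1 by omega, ← Sodd_two_mul_add_two q m]
    exact (Aval_two_mul_lower_bounds q (m + 1) fun i h1 h2 => hq i h1 (by omega)).2
end

section
/- For each integer b ≥ 2, the number of values ε ∈ {0, 1, …, b² − 1} for which F(b², ε) ≤ b + 2 is at least (b² + b)/2. -/
theorem F_add_right_self (x y : ℕ) : F (x + y) y = F x y := by
  rcases Nat.eq_zero_or_pos y with rfl | hy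
  · rfl
  · rw [F_of_pos _ hy, F_of_pos _ hy, Nat.add_mod_right]

theorem F_add_of_le {y z : ℕ} (hy : 0 < y) (hyz : y ≤ z) : F (y + z) z = 1 + F z (z - y) := by
  rw [F_add_right_self, F_of_pos _ (hy.trans_le hyz)]
  rcases hyz.eq_or_lt with rfl | h
  · simp
  · rw [Nat.mod_eq_of_lt h, Nat.mod_eq_of_lt (by omega)]

theorem F_pos (x y : ℕ) : 0 < F x y := by
  rw [F]; split <;> omega

theorem F_mul_right {k : ℕ} (hk : 0 < k) (x y : ℕ) : F (x * k) (y * k) = F x y := by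
  induction y using Nat.strong_induction_on generalizing x with
  | _ y ih =>
    rcases Nat.eq_zero_or_pos y with rfl | hy
    · rw [zero_mul, F_zero_right, F_zero_right]
    · rw [F_of_pos _ hy, F_of_pos _ (Nat.mul_pos hy hk), Nat.mul_mod_mul_right, ← Nat.sub_mul,
        Nat.mul_mod_mul_right, ih _ (Nat.mod_lt _ hy)]

/-- The lengths of the negative continued fractions of `x / y` and `x / (x - y)` have product
less than `x`. -/
theorem F_sub_one_mul_F_sub_one_lt (y z : ℕ) (h : 0 < y + z) :
    (F (y + z) y - 1) * (F (y + z) z - 1) < y + z := by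
  induction hn : y + z using Nat.strong_induction_on generalizing y z with
  | _ n ih =>
    subst hn
    wlog hyz : y ≤ z generalizing y z
    · have := this z y (by omega) (fun m hm => ih m (by omega)) (by omega)
      rwa [mul_comm, add_comm y z]
    rcases Nat.eq_zero_or_pos y with rfl | hy
    · simpa [F_zero_right] using h
    · have hrec := ih z (by omega) y (z - y) (by omega) (by omega)
      have hle := F_le_succ z y
      rw [F_add_of_le hy hyz, add_comm y z, F_add_right_self]
      obtain ⟨s, hs⟩ := Nat.exists_eq_add_one.2 (F_pos z (z - y))
      rw [hs] at hrec ⊢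
      rw [Nat.add_sub_cancel_left, Nat.mul_succ]
      rw [Nat.add_sub_cancel] at hrec
      omega

/-- **Lemma 4.8.**  For each `b ≥ 2`, there are at least `(b² + b)/2` values
`ε ∈ {0, 1, …, b² - 1}` for which `F(b², ε) ≤ b + 2`. -/
theorem count_small_F (b : ℕ) (hb : 2 ≤ b) :
    (b ^ 2 + b) / 2 ≤ ((Finset.range (b ^ 2)).filter fun ε => F (b ^ 2) ε ≤ b + 2).card := by
  have hb0 : 0 < b := by omega
  have hmul (k : ℕ) (hk : k < b) : F (b ^ 2) (k * b) ≤ b + 2 := by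
    rw [sq, F_mul_right hb0]
    have := F_le_succ b k
    omega
  set G := (Finset.range (b ^ 2)).filter fun ε => F (b ^ 2) ε ≤ b + 2
  set B := (Finset.range (b ^ 2)).filter fun ε => ¬ F (b ^ 2) ε ≤ b + 2
  set M := (Finset.range b).image (· * b)
  set R := B.image (b ^ 2 - ·)
  have hM : M.card = b := by
    rw [Finset.card_image_of_injective _ (mul_left_injective₀ hb0.ne'), Finset.card_range]
  have hR : R.card = B.card := by
    refine Finset.card_image_of_injOn fun x hx y hy hxy => ?_
    simp only [B, Finset.coe_filter, Finset.mem_range, Set.mem_ofPred_eq] at hx hy hxy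
    omega
  have hMG : M ⊆ G := by
    refine Finset.image_subset_iff.2 fun k hk => ?_
    rw [Finset.mem_range] at hk
    exact Finset.mem_filter.2 ⟨Finset.mem_range.2 (by nlinarith), hmul k hk⟩
  have hRG : R ⊆ G := by
    refine Finset.image_subset_iff.2 fun y hy => ?_
    simp only [B, Finset.mem_filter, Finset.mem_range, not_le] at hy
    have hy0 : y ≠ 0 := by
      rintro rfl
      rw [F_zero_right] at hy
      omega
    refine Finset.mem_filter.2 ⟨Finset.mem_range.2 (by omega), ?_⟩
    by_contra! hbad
    have hlt := F_sub_one_mul_F_sub_one_lt y (b ^ 2 - y) (by omega)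
    rw [Nat.add_sub_cancel' hy.1.le] at hlt
    have := Nat.mul_le_mul (show b ≤ F (b ^ 2) y - 1 by omega)
      (show b ≤ F (b ^ 2) (b ^ 2 - y) - 1 by omega)
    rw [← sq] at this
    omega
  have hdisj : Disjoint M R := by
    refine Finset.disjoint_left.2 fun m hm hr => ?_
    obtain ⟨k, hk, rfl⟩ := Finset.mem_image.1 hm
    obtain ⟨y, hy, hyk⟩ := Finset.mem_image.1 hr
    simp only [B, Finset.mem_filter, Finset.mem_range] at hy hk hyk
    have hyeq : y = (b - k) * b := by
      rw [Nat.sub_mul, ← sq]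
      omega
    have hk0 : k ≠ 0 := by
      rintro rfl
      omega
    exact hy.2 (hyeq ▸ hmul (b - k) (by omega))
  have hcard : M.card + R.card ≤ G.card := by
    rw [← Finset.card_union_of_disjoint hdisj]
    exact Finset.card_le_card (Finset.union_subset hMG hRG)
  have htotal : G.card + B.card = b ^ 2 := by
    rw [Finset.card_filter_add_card_filter_not, Finset.card_range]
  omega
end
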